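/- arXiv:1005.4218 — 14 statements merged into one kernel-verified Lean document; each statement's English description precedes it below -/
import Mathlib

section
/- If a real polynomial p(x) = a_0 + a_1 x + ... + a_n x^n has only real negative zeros, then the polynomial q(x) = sum_{k=0}^n (a_k^2 - a_{k-1} a_{k+1}) x^k also has only real negative zeros, where by convention a_{-1} = a_{n+1} = 0. -/
open Polynomial Finset

theorem eval_derivative_sub_C_mul_ne_zero {f : ℂ[X]} {w r z : ℂ} {c : ℝ}
    (hf : ∀ x, f.IsRoot x → (w * x).re ≤ c) (hr : r ≠ 0) (hrw : (r / w).re ≤ 0)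
    (hz : c < (w * z).re) : (derivative f - C r * f).eval z ≠ 0 := by
  intro h
  have hfz : f.eval z ≠ 0 := fun h0 ↦ (hf z h0).not_gt hz
  have hlog := (IsAlgClosed.splits f).eval_derivative_div_eval_of_ne_zero hfz
  have hr' : r = (derivative f).eval z / f.eval z := by
    rw [eq_div_iff hfz]
    simp only [eval_sub, eval_mul, eval_C] at h
    linear_combination -h
  rw [hlog] at hr'
  have hre : (r / w).re = (f.roots.map fun x ↦ (1 / (w * (z - x))).re).sum := by
    have hmap := AddMonoidHom.map_multiset_sum
      (Complex.reAddGroupHom.comp (AddMonoidHom.mulRight w⁻¹)) (f.roots.map fun x ↦ 1 / (z - x))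
    rw [← hr', Multiset.map_map] at hmap
    simpa [div_eq_mul_inv, Function.comp_def, mul_comm] using hmap
  have hpos : ∀ x ∈ f.roots, 0 < (1 / (w * (z - x))).re := by
    intro x hx
    have hx' := hf x (isRoot_of_mem_roots hx)
    have h1 : 0 < (w * (z - x)).re := by rw [mul_sub, Complex.sub_re]; linarith
    rw [one_div, Complex.inv_re]
    refine div_pos h1 (Complex.normSq_pos.2 fun h0 ↦ ?_)
    rw [h0] at h1
    simp at h1
  have hroots : f.roots ≠ 0 := by
    intro h0
    rw [h0] at hr'
    exact hr (by simpa using hr')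
  refine hrw.not_gt ?_
  rw [hre]
  obtain ⟨x, hx⟩ := Multiset.exists_mem_of_ne_zero hroots
  refine (hpos x hx).trans_le (Multiset.single_le_sum ?_ _ (Multiset.mem_map_of_mem _ hx))
  simp only [Multiset.mem_map]
  rintro _ ⟨y, hy, rfl⟩
  exact (hpos y hy).le

theorem natDegree_derivative_sub_C_mul_le {f : ℂ[X]} {n : ℕ} (hn : f.natDegree ≤ n) (r : ℂ) :
    (derivative f - C r * f).natDegree ≤ n :=
  (natDegree_sub_le _ _).trans <| max_le ((natDegree_derivative_le f).trans (by lia))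
    ((natDegree_C_mul_le r f).trans hn)

theorem coeff_derivative_sub_C_mul {f : ℂ[X]} {n : ℕ} (hn : f.natDegree ≤ n) (r : ℂ) :
    (derivative f - C r * f).coeff n = -r * f.coeff n := by
  simp [coeff_derivative, coeff_eq_zero_of_natDegree_lt (Nat.lt_succ_of_le hn)]

/-- A constant-coefficient differential operator whose symbol has all its roots in a suitable
half-plane preserves the property of having all roots in a given half-plane. -/
theorem aeval_derivative_multiset_prod {f : ℂ[X]} {w : ℂ} {c : ℝ} {n : ℕ} (s : Multiset ℂ)
    (hs : ∀ r ∈ s, r ≠ 0 ∧ (r / w).re ≤ 0)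
    (hf : ∀ x, f.IsRoot x → (w * x).re ≤ c) (hn : f.natDegree ≤ n) (hfn : f.coeff n ≠ 0) :
    let P := (s.map fun r ↦ X - C r).prod
    let g := aeval (derivative : Module.End ℂ ℂ[X]) P f
    (∀ x, g.IsRoot x → (w * x).re ≤ c) ∧ g.natDegree ≤ n ∧
      g.coeff n = P.eval 0 * f.coeff n ∧ g.coeff n ≠ 0 := by
  induction s using Multiset.induction_on with
  | empty =>
    simp only [Multiset.map_zero, Multiset.prod_zero, map_one, Module.End.one_apply, eval_one,
      one_mul]
    exact ⟨hf, hn, trivial, hfn⟩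
  | cons r s ih =>
    obtain ⟨h1, h2, h3, h4⟩ := ih fun x hx ↦ hs x (Multiset.mem_cons_of_mem hx)
    obtain ⟨hr, hrw⟩ := hs r (Multiset.mem_cons_self r s)
    set g := aeval (derivative : Module.End ℂ ℂ[X]) (s.map fun r ↦ X - C r).prod f with hg
    have hstep : aeval (derivative : Module.End ℂ ℂ[X]) ((r ::ₘ s).map fun r ↦ X - C r).prod f =
        derivative g - C r * g := by
      simp [hg, Module.algebraMap_end_apply, smul_eq_C_mul]
    have hc := coeff_derivative_sub_C_mul h2 r
    simp only [hstep]
    refine ⟨fun x hx ↦ ?_, natDegree_derivative_sub_C_mul_le h2 r, ?_, ?_⟩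
    · by_contra! hlt
      exact eval_derivative_sub_C_mul_ne_zero h1 hr hrw hlt hx
    · rw [hc, h3]
      simp [mul_assoc]
    · rw [hc]
      exact mul_ne_zero (neg_ne_zero.2 hr) h4

/-- The Laguerre-type polynomial `∑ₖ (m choose k) uᵏ / (k + 1)!` has only nonpositive zeros. -/
theorem laguerre_root {m : ℕ} {u : ℂ}
    (hu : ∑ k ∈ range (m + 1), (m.choose k : ℂ) / ((k + 1).factorial : ℂ) * u ^ k = 0) :
    u.re ≤ 0 ∧ u.im = 0 := by
  set s : Multiset ℂ := Multiset.replicate m 1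
  set g := aeval (derivative : Module.End ℂ ℂ[X]) (s.map fun r ↦ X - C r).prod (X ^ (m + 1))
    with hg
  have hexp : g.eval (-u) = 0 := by
    have h1 : g = ∑ k ∈ range (m + 1), (m.choose k : ℂ) • ((-1 : ℂ) ^ k •
        (derivative^[m - k] (X ^ (m + 1) : ℂ[X]))) := by
      have : (s.map fun r ↦ X - C r).prod =
          ∑ k ∈ range (m + 1), ((m.choose k : ℂ) * (-1 : ℂ) ^ k) • (X : ℂ[X]) ^ (m - k) := by
        rw [Multiset.map_replicate, Multiset.prod_replicate, sub_eq_add_neg, add_comm, add_pow]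
        refine sum_congr rfl fun k _ ↦ ?_
        rw [smul_eq_C_mul]
        simp
        ring
      rw [hg, this]
      simp only [map_sum, map_smul, map_pow, aeval_X, LinearMap.sum_apply, LinearMap.smul_apply,
        Module.End.pow_apply, mul_smul]
    rw [h1, eval_finsetSum]
    have h2 : ∀ k ∈ range (m + 1), eval (-u) ((m.choose k : ℂ) • ((-1 : ℂ) ^ k •
        (derivative^[m - k] (X ^ (m + 1) : ℂ[X])))) = (-u * (m + 1).factorial) *
        ((m.choose k : ℂ) / ((k + 1).factorial : ℂ) * u ^ k) := by
      intro k hk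
      rw [mem_range] at hk
      have hd : (((k + 1).factorial : ℂ)) * ((m + 1).descFactorial (m - k) : ℂ) =
          ((m + 1).factorial : ℂ) := by
        have := Nat.factorial_mul_descFactorial (show m - k ≤ m + 1 by lia)
        rw [show m + 1 - (m - k) = k + 1 by lia] at this
        exact_mod_cast this
      have hk0 : ((k + 1).factorial : ℂ) ≠ 0 := by exact_mod_cast (k + 1).factorial_ne_zero
      rw [iterate_derivative_X_pow_eq_smul, show m + 1 - (m - k) = k + 1 by lia, ← hd]
      have : (-u) ^ k = (-1) ^ k * u ^ k := by rw [← mul_pow]; simp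
      simp only [eval_smul, eval_pow, eval_X, smul_eq_mul]
      rw [pow_succ, this]
      have h11 : ((-1 : ℂ) ^ k) * (-1) ^ k = 1 := by rw [← mul_pow]; simp
      field_simp
      linear_combination (- (m.choose k : ℂ) * ((m + 1).descFactorial (m - k) : ℂ) * u * u ^ k) * h11
    rw [sum_congr rfl h2, ← mul_sum, hu, mul_zero]
  have key : ∀ w : ℂ, (1 / w).re ≤ 0 → (w * -u).re ≤ 0 := by
    intro w hw
    refine (aeval_derivative_multiset_prod (f := X ^ (m + 1)) (w := w) (c := 0) (n := m + 1) s
      ?_ ?_ (by simp) (by simp)).1 (-u) hexp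
    · intro r hr
      rw [Multiset.eq_of_mem_replicate hr]
      exact ⟨one_ne_zero, hw⟩
    · intro x hx
      have : x = 0 := by simpa using hx
      simp [this]
  have h1 := key (-1) (by simp)
  have h2 := key Complex.I (by simp)
  have h3 := key (-Complex.I) (by simp)
  simp at h1 h2 h3
  exact ⟨h1, le_antisymm h2 h3⟩

theorem norm_aeval_derivative_eval_zero_ge {f A : ℂ[X]} {δ : ℝ} (hδ : 0 ≤ δ) (hA : A.eval 0 ≠ 0)
    (hroot : ∀ r, A.IsRoot r → r.re = 0) (hf0 : f ≠ 0) (hf : ∀ x, f.IsRoot x → x.re ≤ -δ) :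
    ‖A.eval 0 * f.leadingCoeff‖ * δ ^ f.natDegree ≤
      ‖(aeval (derivative : Module.End ℂ ℂ[X]) A f).eval 0‖ := by
  obtain ⟨h1, h2, h3, h4⟩ := aeval_derivative_multiset_prod (f := f) (w := 1) (c := -δ) A.roots
    (fun r hr ↦ ⟨fun h ↦ hA (by simpa [h] using isRoot_of_mem_roots hr),
      by simp [hroot r (isRoot_of_mem_roots hr)]⟩)
    (by simpa only [one_mul] using hf) le_rfl (by simpa using hf0)
  have hsplit := (IsAlgClosed.splits A).eq_prod_roots
  set P := (A.roots.map fun r ↦ X - C r).prod with hP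
  set g := aeval (derivative : Module.End ℂ ℂ[X]) P f with hg
  have hAg : aeval (derivative : Module.End ℂ ℂ[X]) A f = A.leadingCoeff • g := by
    rw [hg, ← LinearMap.smul_apply, ← map_smul, smul_eq_C_mul, ← hsplit]
  have hA0 : A.eval 0 = A.leadingCoeff * P.eval 0 := by
    conv_lhs => rw [hsplit]
    simp
  have hdeg : g.natDegree = f.natDegree := le_antisymm h2 (le_natDegree_of_ne_zero h4)
  have hnorm : ∀ s : Multiset ℂ, (∀ x ∈ s, x.re ≤ -δ) →
      δ ^ s.card ≤ ‖(s.map fun x ↦ 0 - x).prod‖ := by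
    intro s
    induction s using Multiset.induction_on with
    | empty => simp
    | cons x s ih =>
      intro hs
      have hx : δ ≤ ‖0 - x‖ := by
        have := hs x (Multiset.mem_cons_self x s)
        rw [zero_sub, norm_neg]
        linarith [neg_le_abs x.re, Complex.abs_re_le_norm x]
      have := ih fun y hy ↦ hs y (Multiset.mem_cons_of_mem hy)
      simp only [Multiset.card_cons, Multiset.map_cons, Multiset.prod_cons, norm_mul, pow_succ']
      gcongr
  have hg0 := (IsAlgClosed.splits g).eval_eq_prod_roots 0
  have hlead : g.leadingCoeff = P.eval 0 * f.leadingCoeff := by rw [leadingCoeff, hdeg, h3]; rfl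
  have hbound := hnorm g.roots fun x hx ↦ by simpa using h1 x (isRoot_of_mem_roots hx)
  rw [← (IsAlgClosed.splits g).natDegree_eq_card_roots, hdeg] at hbound
  rw [hAg, eval_smul, smul_eq_mul, hg0, hA0, hlead, mul_assoc A.leadingCoeff,
    norm_mul A.leadingCoeff, norm_mul A.leadingCoeff, norm_mul _ (Multiset.prod _), mul_assoc]
  gcongr

open Filter Topology in
theorem tendsto_choose_div_pow (k : ℕ) :
    Tendsto (fun m : ℕ ↦ (m.choose k : ℂ) / (m : ℂ) ^ k) atTop (𝓝 (1 / (k.factorial : ℂ))) := by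
  have h := isEquivalent_choose k
  have hk : (k.factorial : ℝ) ≠ 0 := by exact_mod_cast k.factorial_ne_zero
  have h2 : Tendsto (fun m : ℕ ↦ (m.choose k : ℝ) / (m : ℝ) ^ k) atTop
      (𝓝 (1 / (k.factorial : ℝ))) := by
    rw [Asymptotics.isEquivalent_iff_tendsto_one] at h
    · have := h.div_const (k.factorial : ℝ)
      refine this.congr' ?_
      filter_upwards [eventually_gt_atTop 0] with m hm
      have : (m : ℝ) ≠ 0 := by positivity
      simp only [Pi.div_apply]
      field_simp
    · filter_upwards [eventually_gt_atTop 0] with m hm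
      positivity
  have h3 := (Complex.continuous_ofReal.tendsto _).comp h2
  simpa [Function.comp_def] using h3

/-- Polynomial approximations, with only imaginary zeros, of the entire function
`∑ₖ z²ᵏ / (k! (k + 1)!)`. -/
noncomputable def besselApprox (m : ℕ) : ℂ[X] :=
  ∑ k ∈ range (m + 1), C ((m.choose k : ℂ) / (m : ℂ) ^ k / ((k + 1).factorial : ℂ)) * X ^ (2 * k)

theorem besselApprox_eval_zero (m : ℕ) : (besselApprox m).eval 0 = 1 := by
  rw [besselApprox, eval_finsetSum, sum_range_succ']
  simp

theorem re_eq_zero_of_besselApprox_isRoot {m : ℕ} (hm : m ≠ 0) {z : ℂ}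
    (hz : (besselApprox m).IsRoot z) : z.re = 0 := by
  have h : ∑ k ∈ range (m + 1), (m.choose k : ℂ) / ((k + 1).factorial : ℂ) *
      (z ^ 2 / m) ^ k = 0 := by
    rw [← show (besselApprox m).eval z = 0 from hz, besselApprox, eval_finsetSum]
    refine sum_congr rfl fun k _ ↦ ?_
    simp only [eval_mul, eval_C, eval_pow, eval_X, div_pow, pow_mul]
    ring
  obtain ⟨h1, h2⟩ := laguerre_root h
  have hm' : (m : ℂ) ≠ 0 := by exact_mod_cast hm
  have hsq : z ^ 2 = (m : ℝ) * (z ^ 2 / m) := by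
    rw [Complex.ofReal_natCast]
    field_simp
  have hre : z.re * z.re - z.im * z.im ≤ 0 := by
    rw [← Complex.mul_re, ← pow_two, hsq, Complex.re_ofReal_mul]
    exact mul_nonpos_of_nonneg_of_nonpos m.cast_nonneg h1
  have him : z.re * z.im + z.im * z.re = 0 := by
    rw [← Complex.mul_im, ← pow_two, hsq, Complex.im_ofReal_mul, h2, mul_zero]
  rcases mul_eq_zero.1 (show z.re * z.im = 0 by linarith) with h | h
  · exact h
  · rw [h] at hre
    nlinarith

theorem aeval_derivative_besselApprox_eval_zero (f : ℂ[X]) {m : ℕ} (hm : f.natDegree ≤ m) :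
    (aeval (derivative : Module.End ℂ ℂ[X]) (besselApprox m) f).eval 0 =
      ∑ k ∈ range (f.natDegree + 1), (m.choose k : ℂ) / (m : ℂ) ^ k / ((k + 1).factorial : ℂ) *
        ((2 * k).factorial * f.coeff (2 * k)) := by
  have : (aeval (derivative : Module.End ℂ ℂ[X]) (besselApprox m) f).eval 0 =
      ∑ k ∈ range (m + 1), (m.choose k : ℂ) / (m : ℂ) ^ k / ((k + 1).factorial : ℂ) *
        ((2 * k).factorial * f.coeff (2 * k)) := by
    simp only [besselApprox, ← smul_eq_C_mul, map_sum, map_smul, map_pow, aeval_X,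
      LinearMap.sum_apply, LinearMap.smul_apply, Module.End.pow_apply, eval_finsetSum, eval_smul,
      smul_eq_mul, ← coeff_zero_eq_eval_zero, coeff_iterate_derivative, zero_add,
      Nat.descFactorial_self, nsmul_eq_mul]
  rw [this]
  refine (sum_subset (range_mono (by lia)) fun k _ hk ↦ ?_).symm
  rw [mem_range] at hk
  rw [coeff_eq_zero_of_natDegree_lt (by lia), mul_zero, mul_zero]

theorem sum_catalan_mul_coeff_ne_zero {f : ℂ[X]} (hf0 : f ≠ 0)
    (hf : ∀ x, f.IsRoot x → x.re < 0) :
    ∑ k ∈ range (f.natDegree + 1), (catalan k : ℂ) * f.coeff (2 * k) ≠ 0 := by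
  obtain ⟨δ, hδ, hfδ⟩ : ∃ δ : ℝ, 0 < δ ∧ ∀ x, f.IsRoot x → x.re ≤ -δ := by
    have : ∀ s : Finset ℂ, (∀ x ∈ s, x.re < 0) → ∃ δ : ℝ, 0 < δ ∧ ∀ x ∈ s, x.re ≤ -δ := by
      intro s
      induction s using Finset.induction_on with
      | empty => exact fun _ ↦ ⟨1, one_pos, by simp⟩
      | insert a s _ ih =>
        intro h
        obtain ⟨δ, hδ, hs⟩ := ih fun x hx ↦ h x (mem_insert_of_mem hx)
        have ha := h a (mem_insert_self a s)
        refine ⟨min δ (-a.re), lt_min hδ (by linarith), fun x hx ↦ ?_⟩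
        rcases mem_insert.1 hx with rfl | hx
        · linarith [min_le_right δ (-x.re)]
        · linarith [min_le_left δ (-a.re), hs x hx]
    obtain ⟨δ, hδ, h⟩ := this f.roots.toFinset fun x hx ↦
      hf x (isRoot_of_mem_roots (Multiset.mem_toFinset.1 hx))
    exact ⟨δ, hδ, fun x hx ↦ h x (Multiset.mem_toFinset.2 ((mem_roots hf0).2 hx))⟩
  have hlim : Filter.Tendsto
      (fun m ↦ (aeval (derivative : Module.End ℂ ℂ[X]) (besselApprox m) f).eval 0) Filter.atTop
      (nhds (∑ k ∈ range (f.natDegree + 1), (catalan k : ℂ) * f.coeff (2 * k))) := by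
    have h1 : Filter.Tendsto (fun m : ℕ ↦ ∑ k ∈ range (f.natDegree + 1),
        (m.choose k : ℂ) / (m : ℂ) ^ k / ((k + 1).factorial : ℂ) *
        ((2 * k).factorial * f.coeff (2 * k))) Filter.atTop
        (nhds (∑ k ∈ range (f.natDegree + 1), 1 / (k.factorial : ℂ) / ((k + 1).factorial : ℂ) *
        ((2 * k).factorial * f.coeff (2 * k)))) :=
      tendsto_finsetSum _ fun k _ ↦ ((tendsto_choose_div_pow k).div_const _).mul_const _
    have h2 : ∀ k : ℕ, (catalan k : ℂ) =
        1 / (k.factorial : ℂ) / ((k + 1).factorial : ℂ) * (2 * k).factorial := by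
      intro k
      have hk : (k.factorial : ℂ) ≠ 0 := by exact_mod_cast k.factorial_ne_zero
      have hk1 : (k : ℂ) + 1 ≠ 0 := by exact_mod_cast k.succ_ne_zero
      have e1 : ((k : ℂ) + 1) * catalan k = k.centralBinom := by
        exact_mod_cast succ_mul_catalan_eq_centralBinom k
      have e2 : (k.centralBinom : ℂ) * k.factorial * k.factorial = (2 * k).factorial := by
        have := Nat.choose_mul_factorial_mul_factorial (show k ≤ 2 * k by lia)
        rw [show 2 * k - k = k by lia] at this
        exact_mod_cast this
      rw [Nat.factorial_succ, ← e2, ← e1]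
      push_cast
      field_simp
    simp only [h2, mul_assoc]
    refine h1.congr' ?_
    filter_upwards [Filter.eventually_ge_atTop f.natDegree] with m hm
    simp only [aeval_derivative_besselApprox_eval_zero f hm]
  have hbound : ‖f.leadingCoeff‖ * δ ^ f.natDegree ≤
      ‖∑ k ∈ range (f.natDegree + 1), (catalan k : ℂ) * f.coeff (2 * k)‖ := by
    refine ge_of_tendsto hlim.norm ?_
    filter_upwards [Filter.eventually_ge_atTop 1] with m hm
    have := norm_aeval_derivative_eval_zero_ge hδ.le (A := besselApprox m)
      (by simp [besselApprox_eval_zero])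
      (fun r ↦ re_eq_zero_of_besselApprox_isRoot (by lia)) hf0 hfδ
    rwa [besselApprox_eval_zero, one_mul] at this
  have hpos : 0 < ‖f.leadingCoeff‖ * δ ^ f.natDegree :=
    mul_pos (by simpa using hf0) (pow_pos hδ _)
  exact norm_pos_iff.1 (hpos.trans_le hbound)

open LaurentPolynomial in
/-- The constant term of `(1 - t²) g(t)`. -/
noncomputable def constTerm : ℂ[T;T⁻¹] →ₗ[ℂ] ℂ where
  toFun g := g.coeff 0 - g.coeff (-2)
  map_add' g h := by simp; ring
  map_smul' c g := by simp; ring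

open LaurentPolynomial in
theorem constTerm_T (i : ℤ) :
    constTerm (T i) = (if i = 0 then 1 else 0) - (if i = -2 then 1 else 0) := by
  simp [constTerm]

open LaurentPolynomial in
theorem constTerm_T_add_T_neg_pow (j : ℕ) :
    constTerm ((T 1 + T (-1)) ^ j) = if Even j then (catalan (j / 2) : ℂ) else 0 := by
  have hexp : constTerm ((T 1 + T (-1)) ^ j) = ∑ i ∈ range (j + 1), (j.choose i : ℂ) *
      ((if 2 * i = j then 1 else 0) - (if 2 * i + 2 = j then 1 else 0)) := by
    rw [add_pow, map_sum]
    refine sum_congr rfl fun i hi ↦ ?_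
    rw [mem_range] at hi
    rw [T_pow, T_pow, ← T_add, mul_comm, ← nsmul_eq_mul, map_nsmul, constTerm_T, nsmul_eq_mul]
    congr 3 <;> exact propext (by lia)
  rw [hexp]
  split_ifs with hj
  · obtain ⟨k, rfl⟩ := hj
    rw [show (k + k) / 2 = k by lia]
    rcases k with _ | k
    · simp
    have hsum : ∀ i ∈ range (k + 1 + (k + 1) + 1), ((k + 1 + (k + 1)).choose i : ℂ) *
        ((if 2 * i = k + 1 + (k + 1) then 1 else 0) -
          (if 2 * i + 2 = k + 1 + (k + 1) then 1 else 0)) =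
        (if i = k + 1 then ((k + 1 + (k + 1)).choose i : ℂ) else 0) -
          (if i = k then ((k + 1 + (k + 1)).choose i : ℂ) else 0) := by
      intro i _
      simp only [show 2 * i = k + 1 + (k + 1) ↔ i = k + 1 by lia,
        show 2 * i + 2 = k + 1 + (k + 1) ↔ i = k by lia, mul_sub, mul_ite, mul_one, mul_zero]
    rw [sum_congr rfl hsum, sum_sub_distrib, sum_ite_eq', sum_ite_eq',
      if_pos (mem_range.2 (by lia)), if_pos (mem_range.2 (by lia))]
    have e1 : ((k : ℂ) + 2) * catalan (k + 1) = (k + 1 + (k + 1)).choose (k + 1) := by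
      have := succ_mul_catalan_eq_centralBinom (k + 1)
      rw [Nat.centralBinom, two_mul] at this
      exact_mod_cast this
    have e2 : ((k + 1 + (k + 1)).choose (k + 1) : ℂ) * ((k : ℂ) + 1) =
        (k + 1 + (k + 1)).choose k * ((k : ℂ) + 2) := by
      have := Nat.choose_succ_right_eq (k + 1 + (k + 1)) k
      rw [show k + 1 + (k + 1) - k = k + 2 by lia] at this
      exact_mod_cast this
    have hk : (k : ℂ) + 2 ≠ 0 := by exact_mod_cast (k + 1).succ_ne_zero
    apply mul_left_cancel₀ hk
    linear_combination e2 - e1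
  · refine sum_eq_zero fun i _ ↦ ?_
    rw [Nat.not_even_iff] at hj
    rw [if_neg (by lia), if_neg (by lia), sub_self, mul_zero]

open LaurentPolynomial in
theorem constTerm_aeval (f : ℂ[X]) :
    constTerm (aeval (T 1 + T (-1)) f) =
      ∑ k ∈ range (f.natDegree + 1), (catalan k : ℂ) * f.coeff (2 * k) := by
  rw [aeval_eq_sum_range' (show f.natDegree < 2 * (f.natDegree + 1) by lia), map_sum]
  have : ∀ n (F : ℕ → ℂ), ∑ i ∈ range (2 * n), F i =
      ∑ k ∈ range n, (F (2 * k) + F (2 * k + 1)) := by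
    intro n F
    induction n with
    | zero => simp
    | succ n ih => rw [sum_range_succ, ← ih, mul_add_one, sum_range_succ, sum_range_succ, add_assoc]
  rw [this]
  refine sum_congr rfl fun k _ ↦ ?_
  rw [map_smul, map_smul, constTerm_T_add_T_neg_pow, constTerm_T_add_T_neg_pow,
    if_pos (even_two_mul k), if_neg (by simp), show 2 * k / 2 = k by lia]
  simp [mul_comm]

open LaurentPolynomial in
theorem constTerm_aeval_mul_aeval (P : ℂ[X]) :
    constTerm (aeval (T 1) P * aeval (T (-1)) P) =
      ∑ k ∈ range (P.natDegree + 1), (P.coeff k ^ 2 - P.coeff k * P.coeff (k + 2)) := by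
  rw [aeval_eq_sum_range, aeval_eq_sum_range, sum_mul_sum, map_sum]
  refine sum_congr rfl fun k hk ↦ ?_
  rw [map_sum]
  have : ∀ l ∈ range (P.natDegree + 1),
      constTerm (P.coeff k • T 1 ^ k * P.coeff l • T (-1) ^ l) =
      P.coeff k * ((if l = k then P.coeff l else 0) - (if l = k + 2 then P.coeff l else 0)) := by
    intro l _
    rw [smul_mul_smul_comm, map_smul, T_pow, T_pow, ← T_add, constTerm_T, smul_eq_mul, mul_assoc]
    simp only [show (k : ℤ) * 1 + (l : ℤ) * -1 = 0 ↔ l = k by lia,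
      show (k : ℤ) * 1 + (l : ℤ) * -1 = -2 ↔ l = k + 2 by lia]
    simp only [mul_sub, mul_ite, mul_one, mul_zero]
  rw [sum_congr rfl this, ← mul_sum, sum_sub_distrib, sum_ite_eq', sum_ite_eq', if_pos hk]
  split_ifs with h
  · ring
  · rw [mem_range] at h
    rw [coeff_eq_zero_of_natDegree_lt (show P.natDegree < k + 2 by lia)]
    ring

open LaurentPolynomial in
theorem aeval_prod_mul_aeval_prod {ξ : ℂ} (hξ : ξ ≠ 0) (s : Multiset ℂ) (hs : ∀ r ∈ s, r ≠ 0) :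
    aeval (ξ • (T 1 : ℂ[T;T⁻¹])) (s.map fun r ↦ X - Polynomial.C r).prod *
      aeval (ξ • (T (-1) : ℂ[T;T⁻¹])) (s.map fun r ↦ X - Polynomial.C r).prod =
    (s.map fun r ↦ -(ξ * r)).prod • aeval (T 1 + T (-1) : ℂ[T;T⁻¹])
      (s.map fun r ↦ X - Polynomial.C (ξ / r + r / ξ)).prod := by
  induction s using Multiset.induction_on with
  | empty => simp
  | cons r s ih =>
    have hr := hs r (Multiset.mem_cons_self r s)
    have ih := ih fun x hx ↦ hs x (Multiset.mem_cons_of_mem hx)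
    have hT : (T 1 : ℂ[T;T⁻¹]) * T (-1) = 1 := by rw [← T_add]; simp
    have hfac : (ξ • (T 1 : ℂ[T;T⁻¹]) - algebraMap ℂ _ r) * (ξ • T (-1) - algebraMap ℂ _ r) =
        (-(ξ * r)) • (T 1 + T (-1) - algebraMap ℂ _ (ξ / r + r / ξ)) := by
      have hc : (ξ * r) * (ξ / r + r / ξ) = ξ * ξ + r * r := by field_simp
      have hc' := congrArg (algebraMap ℂ ℂ[T;T⁻¹]) hc
      simp only [map_mul, map_add] at hc'
      simp only [Algebra.smul_def, map_neg, map_mul, map_add]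
      linear_combination (algebraMap ℂ ℂ[T;T⁻¹] ξ) ^ 2 * hT - hc'
    simp only [Multiset.map_cons, Multiset.prod_cons, map_mul, map_sub, aeval_X, aeval_C]
    rw [mul_mul_mul_comm, hfac, ih, smul_mul_smul_comm]

theorem exists_sq_eq_re_pos {z : ℂ} (hz : ¬ ∃ x : ℝ, x ≤ 0 ∧ (x : ℂ) = z) :
    ∃ ξ : ℂ, ξ ^ 2 = z ∧ 0 < ξ.re := by
  obtain ⟨ξ, hξ⟩ := IsAlgClosed.exists_pow_nat_eq z two_pos
  rcases lt_trichotomy ξ.re 0 with h | h | h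
  · exact ⟨-ξ, by rw [neg_sq, hξ], by simpa using h⟩
  · refine absurd ⟨-(ξ.im ^ 2), by simpa using sq_nonneg _, ?_⟩ hz
    rw [← hξ]
    apply Complex.ext <;> simp [pow_two, h]
  · exact ⟨ξ, hξ, h⟩

open LaurentPolynomial in
theorem sum_coeff_sq_sub_mul_pow_ne_zero {p : ℂ[X]} (hp0 : p ≠ 0)
    (hp : ∀ z, p.IsRoot z → ∃ x : ℝ, x < 0 ∧ (x : ℂ) = z) {ξ : ℂ} (hξ : 0 < ξ.re) :
    ∑ k ∈ range (p.natDegree + 1),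
      ((p.coeff k * ξ ^ k) ^ 2 - p.coeff k * ξ ^ k * (p.coeff (k + 2) * ξ ^ (k + 2))) ≠ 0 := by
  have hξ0 : ξ ≠ 0 := by
    rintro rfl
    simp at hξ
  set P := p.comp (Polynomial.C ξ * X)
  have hcoeff : ∀ k, P.coeff k = p.coeff k * ξ ^ k := fun k ↦ comp_C_mul_X_coeff
  have hdeg : P.natDegree = p.natDegree := by
    rw [natDegree_comp, natDegree_C_mul_X _ hξ0, mul_one]
  have hneg : ∀ r ∈ p.roots, ∃ x : ℝ, x < 0 ∧ (x : ℂ) = r :=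
    fun r hr ↦ hp r (isRoot_of_mem_roots hr)
  have hr0 : ∀ r ∈ p.roots, r ≠ 0 := by
    intro r hr
    obtain ⟨x, hx, rfl⟩ := hneg r hr
    exact_mod_cast hx.ne
  have haeval : ∀ t : ℂ[T;T⁻¹], aeval t P =
      p.leadingCoeff • aeval (ξ • t) (p.roots.map fun r ↦ X - Polynomial.C r).prod := by
    intro t
    rw [aeval_comp, map_mul, aeval_C, aeval_X, ← Algebra.smul_def, ← map_smul,
      Polynomial.smul_eq_C_mul, ← (IsAlgClosed.splits p).eq_prod_roots]
  have hCT := constTerm_aeval_mul_aeval P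
  rw [haeval, haeval, smul_mul_smul_comm, aeval_prod_mul_aeval_prod hξ0 _ hr0, map_smul, map_smul,
    constTerm_aeval, hdeg] at hCT
  simp only [hcoeff] at hCT
  rw [← hCT]
  set f := (p.roots.map fun r ↦ X - Polynomial.C (ξ / r + r / ξ)).prod with hf
  have hf0 : f ≠ 0 := by
    refine (monic_multiset_prod_of_monic _ _ fun r _ ↦ monic_X_sub_C _).ne_zero
  refine smul_ne_zero (by simpa using hp0) (smul_ne_zero ?_ (sum_catalan_mul_coeff_ne_zero hf0 ?_))
  · refine Multiset.prod_ne_zero fun h ↦ ?_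
    obtain ⟨r, hr, h⟩ := Multiset.mem_map.1 h
    exact neg_ne_zero.2 (mul_ne_zero hξ0 (hr0 r hr)) h
  · intro x hx
    rw [IsRoot.def, hf, eval_multiset_prod, Multiset.prod_eq_zero_iff, Multiset.map_map] at hx
    obtain ⟨r, hr, h⟩ := Multiset.mem_map.1 hx
    obtain ⟨y, hy, rfl⟩ := hneg r hr
    simp only [Function.comp_apply, eval_sub, eval_X, eval_C, sub_eq_zero] at h
    rw [h, Complex.add_re, Complex.div_ofReal_re, div_eq_mul_inv (y : ℂ), Complex.re_ofReal_mul,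
      Complex.inv_re]
    have h1 : ξ.re / y < 0 := div_neg_of_pos_of_neg hξ hy
    have h2 : y * (ξ.re / Complex.normSq ξ) < 0 :=
      mul_neg_of_neg_of_pos hy (div_pos hξ (Complex.normSq_pos.2 hξ0))
    linarith

/-- **Brändén's theorem (Fisk–Stanley–McNamara–Sagan conjecture).**
If a real polynomial `p(x) = a₀ + a₁ x + ⋯ + aₙ xⁿ` has only real negative zeros, then
`q(x) = ∑ₖ (aₖ² - aₖ₋₁ aₖ₊₁) xᵏ` also has only real negative zeros
(with the convention `a₋₁ = aₙ₊₁ = 0`). -/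
theorem S1_preserves_real_negative_zeros (p : Polynomial ℝ)
    (hp : ∀ z : ℂ, aeval z p = 0 → ∃ x : ℝ, x < 0 ∧ (x : ℂ) = z) :
    ∀ z : ℂ,
      aeval z (∑ k ∈ range (p.natDegree + 1),
          C ((p.coeff k) ^ 2 - (if k = 0 then 0 else p.coeff (k - 1)) * p.coeff (k + 1)) * X ^ k)
        = 0 →
      ∃ x : ℝ, x < 0 ∧ (x : ℂ) = z := by
  intro z hz
  have ha0 : p.coeff 0 ≠ 0 := by
    intro h
    obtain ⟨x, hx, hx0⟩ := hp 0 (by simp [aeval_def, eval₂_at_zero, h])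
    exact hx.ne (by exact_mod_cast hx0)
  by_contra hcon
  by_cases hz0 : z = 0
  · subst hz0
    rw [map_sum, sum_range_succ'] at hz
    simp at hz
    exact ha0 hz
  obtain ⟨ξ, rfl, hξ⟩ : ∃ ξ : ℂ, ξ ^ 2 = z ∧ 0 < ξ.re := by
    refine exists_sq_eq_re_pos ?_
    rintro ⟨x, hx, rfl⟩
    exact hcon ⟨x, hx.lt_of_ne (by exact_mod_cast hz0), rfl⟩
  have hp0 : p ≠ 0 := fun h ↦ ha0 (by simp [h])
  refine sum_coeff_sq_sub_mul_pow_ne_zero (p := p.map (algebraMap ℝ ℂ))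
    ((Polynomial.map_ne_zero_iff (algebraMap ℝ ℂ).injective).2 hp0)
    (fun x hx ↦ hp x (by simpa [aeval_def, eval_map] using hx)) hξ ?_
  rw [natDegree_map, ← hz, map_sum]
  have hcoeff : ∀ k, (p.map (algebraMap ℝ ℂ)).coeff k = (p.coeff k : ℂ) := fun k ↦ by
    simp [coeff_map]
  have hterm : ∀ k, aeval (ξ ^ 2) (C ((p.coeff k) ^ 2 -
      (if k = 0 then 0 else p.coeff (k - 1)) * p.coeff (k + 1)) * X ^ k) =
      ((p.coeff k : ℂ) * ξ ^ k) ^ 2 -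
        (if k = 0 then 0 else (p.coeff (k - 1) : ℂ)) * p.coeff (k + 1) * (ξ ^ k) ^ 2 := by
    intro k
    split_ifs <;> simp <;> ring
  simp only [hcoeff, hterm, sum_sub_distrib]
  congr 1
  rw [sum_range_succ, sum_range_succ',
    coeff_eq_zero_of_natDegree_lt (show p.natDegree < p.natDegree + 2 by lia)]
  simp only [Complex.ofReal_zero, zero_mul, mul_zero, if_true, add_zero, Nat.add_sub_cancel]
  refine sum_congr rfl fun k _ ↦ ?_
  rw [if_neg k.succ_ne_zero]
  ring
end

section
/- Fix natural numbers n and d. If a real polynomial p(x) = sum_{k=0}^m a_k x^k has nonnegative coefficients and only real zeros, then the polynomial sum_{k=0}^m (a_k / (n-k+d)!) x^k, where by convention 1/(n-k+d)! = 0 whenever n-k+d < 0, is either the zero polynomial or has only real zeros. In particular, for every n the polynomial sum_{k=0}^n binom(n,k) x^k / (n-k+d)! has only real negative zeros. -/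
open Polynomial Finset

/-- A complex polynomial is zero or has only real zeros. -/
def ZeroOrRealRooted (f : ℂ[X]) : Prop :=
  f = 0 ∨ ∀ z : ℂ, f.eval z = 0 → z.im = 0

/-- If `r` is real, the operator `D - r` preserves real-rootedness. -/
theorem ZeroOrRealRooted.derivative_sub {f : ℂ[X]} (hf : ZeroOrRealRooted f) {r : ℂ}
    (hr : r.im = 0) : ZeroOrRealRooted (derivative f - C r * f) := by
  rcases hf with rfl | hf
  · left; simp
  by_contra hcon
  simp only [ZeroOrRealRooted, not_or, not_forall] at hcon
  obtain ⟨hne, z, hz, hzim⟩ := hcon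
  have hfz : f.eval z ≠ 0 := fun h => hzim (hf z h)
  have hsum := (IsAlgClosed.splits f).eval_derivative_div_eval_of_ne_zero hfz
  have hquot : (derivative f).eval z / f.eval z = r := by
    rw [div_eq_iff hfz]
    simpa [sub_eq_zero] using hz
  rw [hquot] at hsum
  have him : r.im = -z.im * (f.roots.map fun w => (Complex.normSq (z - w))⁻¹).sum := by
    rw [hsum, ← Complex.coe_imAddGroupHom, map_multiset_sum, Multiset.map_map,
      ← Multiset.sum_map_mul_left]
    refine congrArg Multiset.sum (Multiset.map_congr rfl fun w hw => ?_)
    have hw0 : w.im = 0 := hf w (isRoot_of_mem_roots hw)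
    simp [Complex.inv_im, hw0, div_eq_mul_inv]
  rw [hr, eq_comm, mul_eq_zero, neg_eq_zero, or_iff_right hzim] at him
  have hroots : f.roots = 0 := by
    refine Multiset.eq_zero_of_forall_notMem fun w hw => ?_
    have hle := Multiset.single_le_sum (s := f.roots.map fun w => (Complex.normSq (z - w))⁻¹)
      (Multiset.forall_mem_map_iff.2 fun w _ => inv_nonneg.2 (Complex.normSq_nonneg _)) _
      (Multiset.mem_map_of_mem _ hw)
    have hpos : 0 < (Complex.normSq (z - w))⁻¹ := by
      rw [inv_pos, Complex.normSq_pos, sub_ne_zero]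
      rintro rfl
      exact hfz (isRoot_of_mem_roots hw)
    linarith
  have hr0 : r = 0 := by simpa [hroots] using hsum
  have hconst := (IsAlgClosed.splits f).natDegree_eq_card_roots
  rw [hroots, Multiset.card_zero] at hconst
  exact hne (by rw [hr0, derivative_of_natDegree_zero hconst]; simp)

/-- If `p` has only real zeros, the operator `p(D)` preserves real-rootedness. -/
theorem ZeroOrRealRooted.aeval_derivative {p f : ℂ[X]} (hp : ∀ z : ℂ, p.eval z = 0 → z.im = 0)
    (hf : ZeroOrRealRooted f) :
    ZeroOrRealRooted (aeval (derivative : Module.End ℂ ℂ[X]) p f) := by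
  have hprod : ∀ s : Multiset ℂ, (∀ r ∈ s, r.im = 0) → ZeroOrRealRooted
      (aeval (derivative : Module.End ℂ ℂ[X]) (s.map fun r => X - C r).prod f) := by
    intro s
    induction s using Multiset.induction with
    | empty => simpa using hf
    | cons r s ih =>
      intro hs
      have h := (ih fun w hw => hs w (Multiset.mem_cons_of_mem hw)).derivative_sub
        (hs r (Multiset.mem_cons_self r s))
      simpa [Module.algebraMap_end_apply, smul_eq_C_mul] using h
  have h := hprod p.roots fun r hr => hp r (isRoot_of_mem_roots hr)
  rw [(IsAlgClosed.splits p).eq_prod_roots]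
  rw [map_mul, aeval_C, Module.End.mul_apply, Module.algebraMap_end_apply]
  rcases h with h | h
  · left; rw [h, smul_zero]
  · by_cases ha : p.leadingCoeff = 0
    · left; rw [ha, zero_smul]
    · right
      intro z hz
      rw [eval_smul, smul_eq_mul, mul_eq_zero, or_iff_right ha] at hz
      exact h z hz

theorem descFactorial_div_factorial (N k : ℕ) :
    (N.descFactorial k : ℂ) / N.factorial =
      if k ≤ N then 1 / ((N - k).factorial : ℂ) else 0 := by
  split_ifs with h
  · rw [div_eq_div_iff (by exact_mod_cast N.factorial_ne_zero)
      (by exact_mod_cast (N - k).factorial_ne_zero), one_mul, mul_comm]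
    exact_mod_cast Nat.factorial_mul_descFactorial h
  · rw [Nat.descFactorial_eq_zero_iff_lt.2 (by omega)]
    simp

/-- The polynomial `p(D) Xᴺ / N!` is, up to reversal, `∑ aₖ Xᵏ / (N - k)!`. -/
theorem pow_mul_eval_aeval_derivative (p : ℂ[X]) (N : ℕ) {z : ℂ} (hz : z ≠ 0) :
    z ^ N * (aeval (derivative : Module.End ℂ ℂ[X]) p (X ^ N)).eval z⁻¹ / N.factorial =
      ∑ k ∈ range (p.natDegree + 1),
        p.coeff k * (if k ≤ N then (1 : ℂ) / (N - k).factorial else 0) * z ^ k := by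
  rw [aeval_eq_sum_range, LinearMap.sum_apply, eval_finsetSum, Finset.mul_sum, Finset.sum_div]
  refine Finset.sum_congr rfl fun k _ => ?_
  rw [← descFactorial_div_factorial, LinearMap.smul_apply, Module.End.pow_apply,
    iterate_derivative_X_pow_eq_smul]
  rcases le_or_gt k N with h | h
  · have hpow : z ^ N * z⁻¹ ^ (N - k) = z ^ k := by
      rw [← Nat.add_sub_of_le h, pow_add, Nat.add_sub_cancel_left, mul_assoc, ← mul_pow,
        mul_inv_cancel₀ hz, one_pow, mul_one]
    simp only [eval_smul, eval_pow, eval_X, smul_eq_mul]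
    rw [← hpow]
    ring
  · simp [Nat.descFactorial_eq_zero_iff_lt.2 h]

/-- The sequence `1 / (N - k)!`, extended by zero, is a multiplier sequence. -/
theorem reversed_factorial_real_rooted (N : ℕ) (p : ℝ[X])
    (hp : ∀ z : ℂ, aeval z p = 0 → ∃ x : ℝ, (x : ℂ) = z) {q : ℝ[X]}
    (hq : q = ∑ k ∈ range (p.natDegree + 1),
      C (p.coeff k * (if k ≤ N then (1 : ℝ) / (N - k).factorial else 0)) * X ^ k) :
    q = 0 ∨ ∀ z : ℂ, aeval z q = 0 → ∃ x : ℝ, (x : ℂ) = z := by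
  have hX : ZeroOrRealRooted (X ^ N : ℂ[X]) := by
    right
    intro z hz
    rw [eval_pow, eval_X] at hz
    simp [eq_zero_of_pow_eq_zero hz]
  have hR := hX.aeval_derivative (p := p.map (algebraMap ℝ ℂ)) fun z hz => by
    rw [eval_map_algebraMap] at hz
    obtain ⟨x, rfl⟩ := hp z hz
    exact Complex.ofReal_im x
  have hval : ∀ z : ℂ, z ≠ 0 → aeval z q = z ^ N * (aeval (derivative : Module.End ℂ ℂ[X])
      (p.map (algebraMap ℝ ℂ)) (X ^ N)).eval z⁻¹ / N.factorial := by
    intro z hz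
    rw [pow_mul_eval_aeval_derivative _ _ hz, natDegree_map, hq, map_sum]
    refine Finset.sum_congr rfl fun k _ => ?_
    simp [apply_ite (algebraMap ℝ ℂ)]
  rcases hR with hR | hR
  · left
    refine eq_zero_of_infinite_isRoot q
      ((Set.Ioi_infinite (0 : ℝ)).mono fun x (hx : 0 < x) => ?_)
    have h := hval x (by exact_mod_cast hx.ne')
    rw [hR, eval_zero, mul_zero, zero_div] at h
    have h' : aeval (algebraMap ℝ ℂ x) q = 0 := h
    rw [aeval_algebraMap_apply] at h'
    simpa using h'
  · right
    intro z hz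
    refine ⟨z.re, Complex.conj_eq_iff_re.1 (Complex.conj_eq_iff_im.2 ?_)⟩
    by_cases hz0 : z = 0
    · simp [hz0]
    rw [hval z hz0, div_eq_zero_iff, or_iff_left (by exact_mod_cast N.factorial_ne_zero), mul_eq_zero,
      or_iff_right (pow_ne_zero _ hz0)] at hz
    have him := hR _ hz
    rw [Complex.inv_im, div_eq_zero_iff, neg_eq_zero] at him
    exact him.resolve_right (by simpa using hz0)

/-- For fixed `n, d : ℕ`, the sequence `{1/(n-k+d)!}ₖ` (with `1/m! = 0` for `m < 0`) is a
multiplier sequence: applying it coefficientwise to a real polynomial with nonnegative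
coefficients and only real zeros yields the zero polynomial or a polynomial with only real
zeros.  In particular, `∑_{k=0}^n (binom(n,k)/(n-k+d)!) xᵏ` has only real negative zeros. -/
theorem reversed_factorial_multiplier_sequence (n d : ℕ) :
    (∀ p : Polynomial ℝ, (∀ k, 0 ≤ p.coeff k) →
      (∀ z : ℂ, aeval z p = 0 → ∃ x : ℝ, (x : ℂ) = z) →
      (let q := ∑ k ∈ range (p.natDegree + 1),
        C (p.coeff k * (if k ≤ n + d then (1 : ℝ) / (n + d - k).factorial else 0)) * X ^ k
       q = 0 ∨ ∀ z : ℂ, aeval z q = 0 → ∃ x : ℝ, (x : ℂ) = z)) ∧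
    (∀ z : ℂ,
      aeval z (∑ k ∈ range (n + 1),
          C ((n.choose k : ℝ) / (n - k + d).factorial) * X ^ k) = 0 →
      ∃ x : ℝ, x < 0 ∧ (x : ℂ) = z) := by
  refine ⟨fun p _ hp => reversed_factorial_real_rooted (n + d) p hp rfl, ?_⟩
  set q : ℝ[X] := ∑ k ∈ range (n + 1), C ((n.choose k : ℝ) / (n - k + d).factorial) * X ^ k
    with hq
  have hpos : ∀ x : ℝ, 0 ≤ x → 0 < q.eval x := by
    intro x hx
    rw [hq, eval_finsetSum]
    refine Finset.sum_pos' (fun k _ => ?_) ⟨0, by simp, ?_⟩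
    · simp only [eval_mul, eval_C, eval_pow, eval_X]
      positivity
    · simp [Nat.factorial_pos]
  have hdeg : ((X + 1 : ℝ[X]) ^ n).natDegree = n := by
    rw [natDegree_pow, ← C_1, natDegree_X_add_C, mul_one]
  have hreal := reversed_factorial_real_rooted (n + d) ((X + 1) ^ n) (q := q) (fun z hz => by
    refine ⟨-1, ?_⟩
    have h : z + 1 = 0 := eq_zero_of_pow_eq_zero (n := n) (by simpa using hz)
    rw [eq_neg_of_add_eq_zero_left h]
    simp) (by
    rw [hq, hdeg]
    refine Finset.sum_congr rfl fun k hk => ?_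
    have hk' : k ≤ n := Nat.lt_succ_iff.1 (Finset.mem_range.1 hk)
    rw [coeff_X_add_one_pow, if_pos (by omega), Nat.sub_add_comm hk', mul_one_div])
  intro z hz
  have hq0 : q ≠ 0 := fun h => by simpa [h] using hpos 0 le_rfl
  obtain ⟨x, rfl⟩ := hreal.resolve_left hq0 z hz
  refine ⟨x, ?_, rfl⟩
  by_contra hx
  have h : aeval (algebraMap ℝ ℂ x) q = 0 := hz
  rw [aeval_algebraMap_apply] at h
  exact (hpos x (not_lt.1 hx)).ne' (by simpa using h)
end

section
/- Let b_k = a_k^2 - a_{k-6} a_{k+6}, where a_j = 1/j! for j >= 0 and a_j = 0 for j < 0, so that b_k = (720 + 1884 k + 1350 k^2 + 960 k^3 + 90 k^4 + 36 k^5) / (k! (6+k)!) for all k >= 0. Set c_k = b_k * 43^k. Then: (i) c_k >= c_{k+1} for all k >= 7; and (ii) for each j = 0, 1, 2, the tail of the j-th derivative of f(x) = sum_{k>=0} b_k x^k after the partial sum of degree 30 satisfies |sum_{k=31}^infinity b_k * k(k-1)...(k-j+1) * (-43)^{k-j}| < 5 * 10^{-18}. -/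
open Finset

/-- The closed form of the coefficients of `S₆[eˣ]`. -/
noncomputable def coeffS6 (k : ℕ) : ℝ :=
  (720 + 1884 * k + 1350 * (k : ℝ) ^ 2 + 960 * (k : ℝ) ^ 3 + 90 * (k : ℝ) ^ 4
    + 36 * (k : ℝ) ^ 5) / (k.factorial * (6 + k).factorial)

theorem coeffS6_nonneg (k : ℕ) : 0 ≤ coeffS6 k := by
  unfold coeffS6
  positivity

theorem sq_sub_eq_coeffS6 (k : ℕ) :
    ((1 : ℝ) / k.factorial) ^ 2
      - (if k < 6 then 0 else (1 : ℝ) / (k - 6).factorial) * (1 / (k + 6).factorial)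
      = coeffS6 k := by
  unfold coeffS6
  rcases lt_or_ge k 6 with h | h
  · interval_cases k <;> norm_num [Nat.factorial]
  · obtain ⟨m, rfl⟩ := Nat.exists_eq_add_of_le' h
    have hm : (m.factorial : ℝ) ≠ 0 := by positivity
    rw [if_neg (by omega), Nat.add_sub_cancel, show 6 + (m + 6) = m + 6 + 6 by ring]
    simp only [Nat.factorial_succ, Nat.cast_mul, Nat.cast_add, Nat.cast_one, Nat.cast_ofNat]
    field_simp
    ring

theorem coeffS6_succ_mul_le {c : ℝ} (k : ℕ)
    (h : c * (720 + 1884 * (k + 1) + 1350 * ((k : ℝ) + 1) ^ 2 + 960 * ((k : ℝ) + 1) ^ 3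
        + 90 * ((k : ℝ) + 1) ^ 4 + 36 * ((k : ℝ) + 1) ^ 5)
      ≤ (k + 1) * (k + 7) * (720 + 1884 * k + 1350 * (k : ℝ) ^ 2 + 960 * (k : ℝ) ^ 3
        + 90 * (k : ℝ) ^ 4 + 36 * (k : ℝ) ^ 5)) :
    coeffS6 (k + 1) * c ≤ coeffS6 k := by
  unfold coeffS6
  rw [← add_assoc 6 k 1, Nat.factorial_succ, Nat.factorial_succ, div_mul_eq_mul_div,
    div_le_div_iff₀ (by positivity) (by positivity)]
  push_cast
  have hf : (0 : ℝ) ≤ k.factorial * (6 + k).factorial := by positivity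
  convert mul_le_mul_of_nonneg_right h hf using 1 <;> ring

theorem coeffS6_succ_mul_43_le {k : ℕ} (hk : 7 ≤ k) : coeffS6 (k + 1) * 43 ≤ coeffS6 k := by
  apply coeffS6_succ_mul_le
  obtain ⟨m, rfl⟩ := Nat.exists_eq_add_of_le' hk
  have hm : (0 : ℝ) ≤ m := m.cast_nonneg
  rw [← sub_nonneg]
  push_cast
  ring_nf
  positivity

theorem coeffS6_succ_mul_860_le {k : ℕ} (hk : 31 ≤ k) : coeffS6 (k + 1) * 860 ≤ coeffS6 k := by
  apply coeffS6_succ_mul_le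
  obtain ⟨m, rfl⟩ := Nat.exists_eq_add_of_le' hk
  have hm : (0 : ℝ) ≤ m := m.cast_nonneg
  rw [← sub_nonneg]
  push_cast
  ring_nf
  positivity

/-- A series whose terms shrink at least tenfold at each step is bounded by `10 / 9` times its
first term. -/
theorem abs_tsum_le_of_abs_succ_le {t : ℕ → ℝ} (h : ∀ k, |t (k + 1)| ≤ |t k| / 10) :
    |∑' k, t k| ≤ |t 0| * (10 / 9) := by
  have hb (k : ℕ) : ‖t k‖ ≤ |t 0| * (1 / 10) ^ k := by
    rw [Real.norm_eq_abs]
    induction k with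
    | zero => simp
    | succ k ih =>
      rw [pow_succ]
      linarith [h k]
  have hg : HasSum (fun k : ℕ => |t 0| * (1 / 10 : ℝ) ^ k) (|t 0| * (10 / 9)) := by
    rw [show (10 / 9 : ℝ) = (1 - 1 / 10)⁻¹ by norm_num]
    exact (hasSum_geometric_of_lt_one (by norm_num) (by norm_num)).mul_left _
  simpa only [Real.norm_eq_abs] using tsum_of_norm_bounded hg hb

theorem prod_sub_succ_le {j : ℕ} (hj : j ≤ 2) (k : ℕ) :
    |∏ i ∈ range j, (((k + 1 : ℕ) : ℝ) + 31 - i)| ≤ 2 * |∏ i ∈ range j, ((k : ℝ) + 31 - i)| := by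
  have hk : (0 : ℝ) ≤ k := k.cast_nonneg
  have hpos (n : ℕ) : 0 ≤ ∏ i ∈ range j, ((n : ℝ) + 31 - i) := by
    refine prod_nonneg fun i hi => ?_
    have : (i : ℝ) ≤ 2 := by exact_mod_cast (mem_range.1 hi).le.trans hj
    linarith [(n.cast_nonneg : (0 : ℝ) ≤ n)]
  rw [abs_of_nonneg (hpos _), abs_of_nonneg (hpos _)]
  interval_cases j <;> simp [prod_range_succ] <;> nlinarith

theorem coeffS6_tail_lt {j : ℕ} (hj : j ≤ 2) :
    |∑' k : ℕ, coeffS6 (k + 31) * (∏ i ∈ range j, ((k : ℝ) + 31 - i))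
        * (-43 : ℝ) ^ (k + 31 - j)| < 5 / 10 ^ 18 := by
  refine (abs_tsum_le_of_abs_succ_le fun k => ?_).trans_lt ?_
  · simp only [abs_mul, abs_pow, abs_neg, Nat.abs_ofNat, abs_of_nonneg (coeffS6_nonneg _)]
    rw [show k + 1 + 31 - j = k + 31 - j + 1 by omega, show k + 1 + 31 = k + 31 + 1 by ring,
      pow_succ]
    have hc := coeffS6_succ_mul_860_le (k := k + 31) (by omega)
    have := mul_le_mul_of_nonneg_right
      (mul_le_mul hc (prod_sub_succ_le hj k) (abs_nonneg _) (coeffS6_nonneg _))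
      (by positivity : (0 : ℝ) ≤ 43 ^ (k + 31 - j))
    linarith
  · unfold coeffS6
    interval_cases j <;> norm_num [prod_range_succ, Nat.factorial, abs_of_nonneg, abs_of_neg]

/-- Error estimates for `f = S₆[eˣ] = ∑ₖ bₖ xᵏ` with `bₖ = aₖ² - aₖ₋₆ aₖ₊₆`, `aⱼ = 1/j!`
(`aⱼ = 0` for `j < 0`): the closed form of `bₖ`, the eventual monotonicity of
`cₖ = bₖ · 43ᵏ`, and the bound `|E₃₀⁽ʲ⁾(-43)| < 5·10⁻¹⁸` on the tails of the `j`-th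
derivative series after the degree-30 partial sum, for `j = 0, 1, 2`. -/
theorem S6_exp_tail_estimates :
    let a : ℕ → ℝ := fun j => 1 / j.factorial
    let b : ℕ → ℝ := fun k => (a k) ^ 2 - (if k < 6 then 0 else a (k - 6)) * a (k + 6)
    (∀ k : ℕ, b k =
        (720 + 1884 * k + 1350 * (k : ℝ) ^ 2 + 960 * (k : ℝ) ^ 3 + 90 * (k : ℝ) ^ 4
            + 36 * (k : ℝ) ^ 5) / (k.factorial * (6 + k).factorial)) ∧
    (∀ k : ℕ, 7 ≤ k → b (k + 1) * 43 ^ (k + 1) ≤ b k * 43 ^ k) ∧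
    (∀ j : ℕ, j ≤ 2 →
      |∑' k : ℕ, b (k + 31) * (∏ i ∈ range j, ((k : ℝ) + 31 - i)) * (-43 : ℝ) ^ (k + 31 - j)| <
        5 / 10 ^ 18) := by
  intro a b
  have hb (k : ℕ) : b k = coeffS6 k := sq_sub_eq_coeffS6 k
  refine ⟨hb, fun k hk => ?_, fun j hj => ?_⟩
  · rw [hb, hb, pow_succ', ← mul_assoc]
    exact mul_le_mul_of_nonneg_right (coeffS6_succ_mul_43_le hk) (by positivity)
  · simp only [hb]
    exact coeffS6_tail_lt hj
end

section
/- Let f : R -> R be the entire function f(x) = sum_{k>=0} b_k x^k, where b_k = a_k^2 - a_{k-6} a_{k+6}, a_j = 1/j! for j >= 0, and a_j = 0 for j < 0. Then at x_0 = -43 the Laguerre expression is negative: (f'(x_0))^2 - f(x_0) f''(x_0) < 0. -/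
open Finset

/-- The shifted coefficients of the termwise derivative of a power series. -/
private noncomputable def derivCoeff (c : ℕ → ℝ) (k : ℕ) : ℝ := (k + 1) * c (k + 1)

private lemma abs_derivCoeff_le {c : ℕ → ℝ} (hc : ∀ k, |c k| ≤ 1 / (k.factorial : ℝ) ^ 2) (k : ℕ) :
    |derivCoeff c k| ≤ 1 / (k.factorial : ℝ) ^ 2 := by
  have h := hc (k + 1)
  have hk : (0 : ℝ) < k.factorial := by positivity
  rw [derivCoeff, abs_mul, abs_of_nonneg (by positivity : (0 : ℝ) ≤ k + 1)]
  refine (mul_le_mul_of_nonneg_left h (by positivity)).trans ?_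
  rw [Nat.factorial_succ, mul_one_div, div_le_div_iff₀ (by positivity) (by positivity)]
  push_cast
  nlinarith [mul_nonneg (mul_nonneg (Nat.cast_nonneg (α := ℝ) k) (by positivity : (0 : ℝ) ≤ k + 1))
    (sq_nonneg (k.factorial : ℝ))]

private lemma abs_le_one_div_factorial {c : ℕ → ℝ}
    (hc : ∀ k, |c k| ≤ 1 / (k.factorial : ℝ) ^ 2) (k : ℕ) : |c k| ≤ 1 / (k.factorial : ℝ) := by
  have hk : (1 : ℝ) ≤ k.factorial := by exact_mod_cast Nat.one_le_iff_ne_zero.2 k.factorial_ne_zero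
  exact (hc k).trans (one_div_le_one_div_of_le (by positivity) (by nlinarith))

private lemma summable_mul_pow {c : ℕ → ℝ} (hc : ∀ k, |c k| ≤ 1 / (k.factorial : ℝ) ^ 2) (x : ℝ) :
    Summable fun k => c k * x ^ k := by
  refine Summable.of_norm_bounded (Real.summable_pow_div_factorial |x|) fun k => ?_
  rw [Real.norm_eq_abs, abs_mul, abs_pow, div_eq_inv_mul, ← one_div]
  exact mul_le_mul_of_nonneg_right (abs_le_one_div_factorial hc k) (by positivity)

private lemma deriv_tsum_mul_pow {c : ℕ → ℝ} (hc : ∀ k, |c k| ≤ 1 / (k.factorial : ℝ) ^ 2) :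
    deriv (fun x : ℝ => ∑' k, c k * x ^ k) = fun x => ∑' k, derivCoeff c k * x ^ k := by
  funext x
  set R : ℝ := |x| + 1
  have hR : 0 < R := by positivity
  have hu : Summable fun k : ℕ => (k : ℝ) * R ^ (k - 1) / k.factorial := by
    refine (summable_nat_add_iff 1).1 ((Real.summable_pow_div_factorial R).congr fun k => ?_)
    rw [Nat.factorial_succ]
    push_cast
    have : (k : ℝ) + 1 ≠ 0 := by positivity
    field_simp
  have h := hasDerivAt_tsum_of_isPreconnected (g := fun k (y : ℝ) => c k * y ^ k)
    (g' := fun k y => c k * (k * y ^ (k - 1))) hu Metric.isOpen_ball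
    (convex_ball (0 : ℝ) R).isPreconnected
    (fun k y _ => (hasDerivAt_pow k y).const_mul (c k))
    (fun k y hy => by
      have hy' : |y| ≤ R := by simpa using (Metric.mem_ball.1 hy).le
      rw [Real.norm_eq_abs, abs_mul, abs_mul, abs_pow, Nat.abs_cast, div_eq_inv_mul, ← one_div]
      have := abs_le_one_div_factorial hc k
      gcongr)
    (Metric.mem_ball_self hR) (summable_mul_pow hc 0)
    (show x ∈ Metric.ball (0 : ℝ) R by simp [R])
  rw [h.deriv]
  have hs := summable_mul_pow (abs_derivCoeff_le hc) x
  have he : (fun k => derivCoeff c k * x ^ k) =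
      fun k => c (k + 1) * (((k + 1 : ℕ) : ℝ) * x ^ (k + 1 - 1)) := by
    funext k
    rw [derivCoeff, Nat.add_sub_cancel]
    push_cast
    ring
  rw [he] at hs ⊢
  rw [((summable_nat_add_iff 1).1 hs :
    Summable fun k : ℕ => c k * ((k : ℝ) * x ^ (k - 1))).tsum_eq_zero_add]
  simp

private lemma abs_tsum_sub_sum_le {c : ℕ → ℝ} (hc : ∀ k, |c k| ≤ 1 / (k.factorial : ℝ) ^ 2) :
    |∑' k, c k * (-43 : ℝ) ^ k - ∑ k ∈ range 24, c k * (-43 : ℝ) ^ k| ≤ 1 / 100000 := by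
  rw [← (summable_mul_pow hc (-43)).sum_add_tsum_nat_add 24, add_sub_cancel_left]
  have hg : HasSum (fun j : ℕ => (1 / 200000 : ℝ) * (1 / 2) ^ j) (1 / 100000) := by
    have h := hasSum_geometric_two.mul_left (1 / 200000 : ℝ)
    rwa [show (1 / 200000 : ℝ) * 2 = 1 / 100000 by norm_num] at h
  rw [← Real.norm_eq_abs]
  refine tsum_of_norm_bounded hg fun j => ?_
  have hf : ((24).factorial : ℝ) * 25 ^ j ≤ ((j + 24).factorial : ℝ) := by
    rw [add_comm j]
    exact_mod_cast Nat.factorial_mul_pow_le_factorial (m := 24) (n := j)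
  rw [Real.norm_eq_abs, abs_mul, abs_pow, abs_neg, abs_of_pos (by norm_num : (0 : ℝ) < 43)]
  calc |c (j + 24)| * 43 ^ (j + 24)
      ≤ 1 / (((24).factorial : ℝ) * 25 ^ j) ^ 2 * 43 ^ (j + 24) := by
        refine mul_le_mul_of_nonneg_right ((hc _).trans ?_) (by positivity)
        gcongr
    _ = 43 ^ 24 / ((24).factorial : ℝ) ^ 2 * (43 / 625) ^ j := by
        rw [div_pow, show (625 : ℝ) = 25 ^ 2 by norm_num, ← pow_mul, mul_pow, ← pow_mul, pow_add,
          mul_comm j 2]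
        field_simp
    _ ≤ 1 / 200000 * (1 / 2) ^ j := by
        refine mul_le_mul (by norm_num) (pow_le_pow_left₀ (by norm_num) (by norm_num) j)
          (by positivity) (by norm_num)

private lemma factorial_sq_le {k : ℕ} (hk : 6 ≤ k) :
    k.factorial ^ 2 ≤ (k - 6).factorial * (k + 6).factorial := by
  have h1 := Nat.choose_mul_factorial_mul_factorial (show k + 6 ≤ 2 * k by omega)
  have h2 := Nat.choose_mul_factorial_mul_factorial (show k ≤ 2 * k by omega)
  rw [show 2 * k - (k + 6) = k - 6 by omega] at h1
  rw [show 2 * k - k = k by omega] at h2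
  have h3 := Nat.choose_le_centralBinom (k + 6) k
  rw [Nat.centralBinom_eq_two_mul_choose] at h3
  refine Nat.le_of_mul_le_mul_left (c := (2 * k).choose k) ?_ (Nat.choose_pos (by omega))
  calc (2 * k).choose k * k.factorial ^ 2
      = (2 * k).choose (k + 6) * ((k - 6).factorial * (k + 6).factorial) := by
        linarith
    _ ≤ _ := Nat.mul_le_mul_right _ h3

/-- The Laguerre expression of `f = S₆[eˣ]` is negative at `x₀ = -43`:
`(f'(x₀))² - f(x₀) f''(x₀) < 0`, where `f(x) = ∑ₖ (aₖ² - aₖ₋₆ aₖ₊₆) xᵏ`, `aⱼ = 1/j!` for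
`j ≥ 0` and `aⱼ = 0` for `j < 0`.  Hence `f ∉ 𝓛-𝓟`. -/
theorem S6_exp_laguerre_negative :
    let b : ℕ → ℝ := fun k =>
      ((1 : ℝ) / k.factorial) ^ 2 -
        (if k < 6 then 0 else (1 : ℝ) / (k - 6).factorial) * ((1 : ℝ) / (k + 6).factorial)
    let f : ℝ → ℝ := fun x => ∑' k : ℕ, b k * x ^ k
    (deriv f (-43)) ^ 2 - f (-43) * deriv (deriv f) (-43) < 0 := by
  intro b f
  have hb : ∀ k, |b k| ≤ 1 / (k.factorial : ℝ) ^ 2 := by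
    intro k
    simp only [b]
    split_ifs with hk
    · rw [zero_mul, sub_zero, div_pow, one_pow, abs_of_pos (by positivity)]
    · have h : ((k.factorial : ℝ)) ^ 2 ≤ (k - 6).factorial * (k + 6).factorial := by
        exact_mod_cast factorial_sq_le (not_lt.1 hk)
      have h' := one_div_le_one_div_of_le (by positivity) h
      have h0 : (0 : ℝ) ≤ 1 / ((k - 6).factorial * (k + 6).factorial) := by positivity
      rw [div_pow, one_pow, one_div_mul_one_div, abs_of_nonneg (by linarith)]
      linarith
  have hb' := abs_derivCoeff_le hb
  have hA := abs_le.1 (abs_tsum_sub_sum_le hb)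
  have hB := abs_le.1 (abs_tsum_sub_sum_le hb')
  have hC := abs_le.1 (abs_tsum_sub_sum_le (abs_derivCoeff_le hb'))
  rw [show deriv f = _ from deriv_tsum_mul_pow hb, deriv_tsum_mul_pow hb']
  have sA : ∑ k ∈ range 24, b k * (-43 : ℝ) ^ k ≤ -(53 / 1000) := by
    norm_num [sum_range_succ, b]
  have sB : |∑ k ∈ range 24, derivCoeff b k * (-43 : ℝ) ^ k| ≤ 1 / 1000 := by
    rw [abs_le]
    constructor <;> norm_num [sum_range_succ, derivCoeff, b]
  have sC : ∑ k ∈ range 24, derivCoeff (derivCoeff b) k * (-43 : ℝ) ^ k ≤ -(39 / 10000) := by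
    norm_num [sum_range_succ, derivCoeff, b]
  have sB := abs_le.1 sB
  have tA : f (-43) ≤ -(5 / 100) := by
    simp only [f]
    linarith [hA.2]
  have tC : ∑' k, derivCoeff (derivCoeff b) k * (-43 : ℝ) ^ k ≤ -(3 / 1000) := by
    linarith [hC.2]
  have tB : (∑' k, derivCoeff b k * (-43 : ℝ) ^ k) ^ 2 ≤ (2 / 1000) ^ 2 :=
    sq_le_sq' (by linarith [hB.1]) (by linarith [hB.2])
  nlinarith [mul_nonneg (sub_nonneg.2 tA) (sub_nonneg.2 tC)]
end

section
/- There exists a real polynomial p(x) = sum_{k=0}^n a_k x^k with nonnegative coefficients and only real zeros such that the polynomial S_6[p](x) = sum_{k=0}^n (a_k^2 - a_{k-6} a_{k+6}) x^k (with a_j = 0 for j < 0 or j > n) is nonzero and fails to have nonnegative coefficients with only real zeros. This answers Fisk's problem in the negative for r = 6. -/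
open Polynomial Finset

/-- The Laguerre inequality `p p'' ≤ p'²` for real polynomials with only real zeros. -/
theorem laguerre_inequality (p : ℝ[X])
    (hp : ∀ z : ℂ, aeval z p = 0 → ∃ x : ℝ, (x : ℂ) = z) (x : ℝ) :
    p.eval x * p.derivative.derivative.eval x ≤ p.derivative.eval x ^ 2 := by
  induction hn : p.natDegree generalizing p with
  | zero =>
    rw [eq_C_of_natDegree_eq_zero hn]
    simp
  | succ n ih =>
    obtain ⟨z, hz⟩ := IsAlgClosed.exists_aeval_eq_zero ℂ p
      (natDegree_pos_iff_degree_pos.mp (by omega)).ne'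
    obtain ⟨r, rfl⟩ := hp z hz
    have hr : p.IsRoot r := by
      have h : aeval (algebraMap ℝ ℂ r) p = 0 := hz
      rw [aeval_algebraMap_apply] at h
      simpa using h
    obtain ⟨g, rfl⟩ := dvd_iff_isRoot.mpr hr
    have hg : g ≠ 0 := by
      rintro rfl
      simp at hn
    have hdeg : g.natDegree = n := by
      rw [natDegree_mul (X_sub_C_ne_zero r) hg, natDegree_X_sub_C] at hn
      omega
    have key := ih g (fun z hz => hp z (by simp [hz])) hdeg
    simp only [derivative_mul, derivative_add, derivative_sub, derivative_X, derivative_C, eval_mul,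
      eval_add, eval_sub, eval_X, eval_C, sub_zero, one_mul]
    nlinarith [mul_nonneg (sq_nonneg (x - r)) (sub_nonneg.mpr key), sq_nonneg (g.eval x)]

/-- The binomial coefficient `n.choose k`, by a recursion with linearly many steps. -/
def fastChoose (n k : ℕ) : ℕ :=
  Nat.rec 1 (fun i c => c * (n - i) / (i + 1)) k

theorem fastChoose_eq (n k : ℕ) : fastChoose n k = n.choose k := by
  induction k with
  | zero => simp [fastChoose]
  | succ k ih =>
    change fastChoose n k * (n - k) / (k + 1) = _
    rw [ih, ← Nat.choose_succ_right_eq, Nat.mul_div_cancel _ k.succ_pos]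

/-- The `k`-th coefficient of `S₆[(1 + x)ⁿ]`. -/
def binomialS6Coeff (n k : ℕ) : ℤ :=
  (n.choose k : ℤ) ^ 2 - (if k < 6 then 0 else (n.choose (k - 6) : ℤ)) * n.choose (k + 6)

/-- Writing the coefficients of `S₆[(1 + x)ⁿ]` as `cₖ = uₖ - vₖ` with
`uₖ = (n.choose k)²`, the sum over `k ≤ n` of `w k * bⁿ⁻ᵏ` times `uₖ` if `k % 2 = s` and
times `vₖ` otherwise. -/
def paritySum (n b : ℕ) (w : ℕ → ℕ) (s : ℕ) : ℕ :=
  ∑ k ∈ range (n + 1), w k * (if k % 2 = s then fastChoose n k ^ 2 else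
    (if k < 6 then 0 else fastChoose n (k - 6)) * fastChoose n (k + 6)) * b ^ (n - k)

/-- The sum of `w k * cₖ * (-1)ᵏ * bⁿ⁻ᵏ` over `k ≤ n`, where `cₖ` are the coefficients of
`S₆[(1 + x)ⁿ]`; for `w = 1` this is `bⁿ` times the value at `-1 / b`. -/
def weightedSum (n b : ℕ) (w : ℕ → ℕ) : ℤ :=
  ∑ k ∈ range (n + 1), (w k : ℤ) * binomialS6Coeff n k * (-1) ^ k * (b : ℤ) ^ (n - k)

theorem weightedSum_eq_sub (n b : ℕ) (w : ℕ → ℕ) :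
    weightedSum n b w = paritySum n b w 0 - paritySum n b w 1 := by
  simp only [weightedSum, paritySum, fastChoose_eq, binomialS6Coeff]
  push_cast
  rw [← sum_sub_distrib]
  refine sum_congr rfl fun k _ => ?_
  rcases Nat.mod_two_eq_zero_or_one k with h | h
  · rw [(Nat.even_iff.mpr h).neg_one_pow]
    simp only [h, if_true, zero_ne_one, if_false]
    ring
  · rw [(Nat.odd_iff.mpr h).neg_one_pow]
    simp only [h, if_true, one_ne_zero, if_false]
    ring

theorem paritySum_laguerre_violation :
    let P := paritySum 400 3876
    P (fun k => k) 0 ^ 2 + P (fun k => k) 1 ^ 2 +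
        P (fun _ => 1) 0 * P (fun k => k * (k - 1)) 1 +
        P (fun _ => 1) 1 * P (fun k => k * (k - 1)) 0 <
      P (fun _ => 1) 0 * P (fun k => k * (k - 1)) 0 +
        P (fun _ => 1) 1 * P (fun k => k * (k - 1)) 1 +
        2 * (P (fun k => k) 0 * P (fun k => k) 1) := by
  decide +kernel

theorem weightedSum_laguerre_violation :
    weightedSum 400 3876 (fun k => k) ^ 2 <
      weightedSum 400 3876 (fun _ => 1) * weightedSum 400 3876 (fun k => k * (k - 1)) := by
  have h := paritySum_laguerre_violation
  zify at h
  simp only [weightedSum_eq_sub]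
  linear_combination h

theorem weightedSum_cast (n b : ℕ) (hb : b ≠ 0) (w : ℕ → ℕ) :
    (weightedSum n b w : ℝ) =
      b ^ n * ∑ k ∈ range (n + 1), (w k : ℝ) * binomialS6Coeff n k * (-1 / b) ^ k := by
  have hb' : (b : ℝ) ≠ 0 := by exact_mod_cast hb
  rw [weightedSum, mul_sum]
  push_cast
  refine sum_congr rfl fun k hk => ?_
  have hk : k ≤ n := by simpa [Nat.lt_succ_iff] using hk
  rw [← Nat.sub_add_cancel hk, pow_add, Nat.add_sub_cancel, div_pow]
  field_simp

theorem mul_eval_derivative_sum (c : ℕ → ℝ) (s : Finset ℕ) (x : ℝ) :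
    x * (∑ k ∈ s, C (c k) * X ^ k).derivative.eval x = ∑ k ∈ s, (k : ℝ) * c k * x ^ k := by
  simp only [derivative_sum, eval_finsetSum, mul_sum, derivative_C_mul_X_pow]
  refine sum_congr rfl fun k _ => ?_
  rcases k with _ | k <;> simp
  ring

theorem sq_mul_eval_derivative_derivative_sum (c : ℕ → ℝ) (s : Finset ℕ) (x : ℝ) :
    x ^ 2 * (∑ k ∈ s, C (c k) * X ^ k).derivative.derivative.eval x =
      ∑ k ∈ s, ((k * (k - 1) : ℕ) : ℝ) * c k * x ^ k := by
  simp only [derivative_sum, eval_finsetSum, mul_sum, derivative_C_mul_X_pow]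
  refine sum_congr rfl fun k _ => ?_
  rcases k with _ | _ | k <;> simp
  ring

theorem eval_laguerre_violation (n b : ℕ) (hb : b ≠ 0)
    (h : weightedSum n b (fun k => k) ^ 2 <
      weightedSum n b (fun _ => 1) * weightedSum n b (fun k => k * (k - 1))) :
    let q : ℝ[X] := ∑ k ∈ range (n + 1), C (binomialS6Coeff n k : ℝ) * X ^ k
    q.derivative.eval (-1 / b : ℝ) ^ 2 <
      q.eval (-1 / b : ℝ) * q.derivative.derivative.eval (-1 / b : ℝ) := by
  intro q
  have hb' : (b : ℝ) ≠ 0 := by exact_mod_cast hb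
  have e0 : q.eval (-1 / b : ℝ) =
      ∑ k ∈ range (n + 1), ((1 : ℕ) : ℝ) * binomialS6Coeff n k * (-1 / b) ^ k := by
    simp [q, eval_finsetSum]
  have e1 := mul_eval_derivative_sum (fun k => binomialS6Coeff n k) (range (n + 1)) (-1 / b)
  have e2 := sq_mul_eval_derivative_derivative_sum (fun k => binomialS6Coeff n k)
    (range (n + 1)) (-1 / b)
  have h' : (weightedSum n b (fun k => k) : ℝ) ^ 2 <
      weightedSum n b (fun _ => 1) * weightedSum n b (fun k => k * (k - 1)) := by
    exact_mod_cast h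
  simp only [weightedSum_cast n b hb] at h'
  rw [← e0, ← e1, ← e2] at h'
  have hc : (0 : ℝ) < ((b : ℝ) ^ n * (-1 / b)) ^ 2 := by positivity
  refine lt_of_mul_lt_mul_left ?_ hc.le
  linear_combination h'

/-- Negative answer to Fisk's problem for `r = 6`: there is a real polynomial `p` with
nonnegative coefficients and only real zeros such that
`S₆[p](x) = ∑ₖ (aₖ² - aₖ₋₆ aₖ₊₆) xᵏ` (out-of-range coefficients taken to be `0`) is nonzero
and fails to have nonnegative coefficients with only real zeros. -/
theorem S6_counterexample :
    ∃ p : Polynomial ℝ,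
      (∀ k, 0 ≤ p.coeff k) ∧
      (∀ z : ℂ, aeval z p = 0 → ∃ x : ℝ, (x : ℂ) = z) ∧
      (let q := ∑ k ∈ range (p.natDegree + 1),
        C ((p.coeff k) ^ 2 - (if k < 6 then 0 else p.coeff (k - 6)) * p.coeff (k + 6)) * X ^ k
       q ≠ 0 ∧
        ¬((∀ k, 0 ≤ q.coeff k) ∧ ∀ z : ℂ, aeval z q = 0 → ∃ x : ℝ, (x : ℂ) = z)) := by
  obtain ⟨n, b, hb, hv⟩ : ∃ n b : ℕ, b ≠ 0 ∧ weightedSum n b (fun k => k) ^ 2 <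
      weightedSum n b (fun _ => 1) * weightedSum n b (fun k => k * (k - 1)) :=
    ⟨400, 3876, by norm_num, weightedSum_laguerre_violation⟩
  have hdeg : ((1 + X : ℝ[X]) ^ n).natDegree = n := by
    rw [natDegree_pow, add_comm, ← C_1, natDegree_X_add_C, mul_one]
  refine ⟨(1 + X) ^ n, fun k => ?_, fun z hz => ⟨-1, ?_⟩, ?_⟩
  · rw [coeff_one_add_X_pow]
    positivity
  · have h : 1 + z = 0 := by
      refine eq_zero_of_pow_eq_zero (n := n) ?_
      simpa only [map_pow, map_add, map_one, aeval_X] using hz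
    push_cast
    linear_combination -h
  intro q
  have hq : q = ∑ k ∈ range (n + 1), C (binomialS6Coeff n k : ℝ) * X ^ k := by
    simp only [q, hdeg, coeff_one_add_X_pow, binomialS6Coeff]
    push_cast
    rfl
  have violation := eval_laguerre_violation n b hb hv
  rw [← hq] at violation
  refine ⟨fun h0 => ?_, fun h => (laguerre_inequality q h.2 _).not_gt violation⟩
  simp [h0] at violation
end

section
/- Let d, n be natural numbers, and set a_m = binom(n, m) for 0 <= m <= n and a_m = 0 otherwise. Then for every k with 0 <= k <= n, the d-by-d determinant D_k^{(d)} = det( (a_{k-i+j})_{0<=i,j<=d-1} ), computed over the rationals, equals prod_{j=0}^{d-1} [ binom(n+j, k+j) / binom(n-k+j, n-k) ]. -/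
open Finset

/-- The coefficient of `X ^ m` in `(1 + X) ^ n`, for an integer exponent `m`. -/
def intChoose (n : ℕ) (m : ℤ) : ℚ := if 0 ≤ m then (n.choose m.toNat : ℚ) else 0

theorem intChoose_natCast (n m : ℕ) : intChoose n m = n.choose m := by
  simp [intChoose]

theorem intChoose_of_neg (n : ℕ) {m : ℤ} (hm : m < 0) : intChoose n m = 0 :=
  if_neg hm.not_ge

theorem intChoose_succ (n : ℕ) (m : ℤ) :
    intChoose (n + 1) (m + 1) = intChoose n m + intChoose n (m + 1) := by
  obtain hm | hm := le_or_gt 0 m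
  · lift m to ℕ using hm
    rw [← Nat.cast_succ, intChoose_natCast, intChoose_natCast, intChoose_natCast,
      Nat.choose_succ_succ, Nat.cast_add]
  · obtain rfl | hm' := eq_or_ne m (-1)
    · simp [intChoose]
    · rw [intChoose_of_neg _ hm, intChoose_of_neg _ (by omega), intChoose_of_neg _ (by omega),
        add_zero]

theorem sum_intChoose_mul_choose (j n : ℕ) (m : ℤ) :
    ∑ l ∈ range (j + 1), intChoose n (m + l) * (j.choose l : ℚ) = intChoose (n + j) (m + j) := by
  induction j generalizing n m with
  | zero => simp
  | succ j ih =>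
    have h₁ : ∑ l ∈ range (j + 1), intChoose n (m + (l + 1 : ℕ)) * (j.choose (l + 1) : ℚ)
        + intChoose n m = ∑ l ∈ range (j + 1), intChoose n (m + l) * (j.choose l : ℚ) := by
      have := sum_range_succ' (fun l : ℕ ↦ intChoose n (m + l) * (j.choose l : ℚ)) (j + 1)
      rw [sum_range_succ] at this
      simpa using this.symm
    rw [sum_range_succ']
    simp only [Nat.choose_succ_succ, Nat.cast_add (j.choose _), mul_add, sum_add_distrib]
    have h₂ : intChoose n (m + (0 : ℕ)) * ((j + 1).choose 0 : ℚ) = intChoose n m := by simp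
    rw [h₂, add_assoc]
    simp only [Nat.succ_eq_add_one]
    rw [h₁, ← sum_add_distrib]
    calc _ = ∑ l ∈ range (j + 1), intChoose (n + 1) (m + 1 + l) * (j.choose l : ℚ) := by
          refine sum_congr rfl fun l _ ↦ ?_
          rw [add_right_comm m 1, intChoose_succ, Nat.cast_succ, ← add_assoc]
          ring
      _ = _ := by
          rw [ih, add_right_comm n 1, Nat.cast_succ, add_assoc m 1, add_comm (1 : ℤ), add_assoc n]

theorem sum_fin_intChoose_mul_choose {d : ℕ} (j : Fin d) (n : ℕ) (m : ℤ) :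
    ∑ l : Fin d, intChoose n (m + l) * ((j : ℕ).choose l : ℚ) = intChoose (n + j) (m + j) := by
  rw [Fin.sum_univ_eq_sum_range (fun l : ℕ ↦ intChoose n (m + l) * ((j : ℕ).choose l : ℚ)),
    ← sum_intChoose_mul_choose]
  refine (sum_subset (range_subset_range.2 j.2) fun l _ hl ↦ ?_).symm
  rw [Nat.choose_eq_zero_of_lt (by simpa using hl), Nat.cast_zero, mul_zero]

theorem det_choose_eq_one (d : ℕ) :
    Matrix.det (Matrix.of fun i j : Fin d ↦ ((j : ℕ).choose i : ℚ)) = 1 := by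
  rw [Matrix.det_of_isUpperTriangular]
  · simp
  · intro i j hij
    have hij : (j : ℕ) < i := hij
    simp [Nat.choose_eq_zero_of_lt hij]

theorem det_intChoose_eq_det_intChoose_add (d n k : ℕ) :
    Matrix.det (Matrix.of fun i j : Fin d ↦ intChoose n (k - i + j)) =
      Matrix.det (Matrix.of fun i j : Fin d ↦ intChoose (n + j) (k - i + j)) := by
  rw [← mul_one (Matrix.det _), ← det_choose_eq_one d, ← Matrix.det_mul]
  congr 1
  ext i j
  simp only [Matrix.mul_apply, Matrix.of_apply, sum_fin_intChoose_mul_choose]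

theorem det_descFactorial (d k : ℕ) :
    Matrix.det (Matrix.of fun i j : Fin d ↦ ((k + j : ℕ).descFactorial i : ℚ)) =
      ∏ j ∈ range d, (j.factorial : ℚ) := by
  have h := Matrix.det_eval_matrixOfPolynomials_eq_det_vandermonde
    (fun j : Fin d ↦ ((k + j : ℕ) : ℚ)) (fun i ↦ descPochhammer ℚ i)
    (fun i ↦ descPochhammer_natDegree ℚ i) (fun i ↦ monic_descPochhammer ℚ i)
  simp only [descPochhammer_eval_eq_descFactorial] at h
  rw [← Matrix.det_transpose]
  refine h.symm.trans ?_
  have h' : (fun j : Fin d ↦ ((k + j : ℕ) : ℚ)) = fun j : Fin d ↦ ((j : ℕ) : ℚ) + k := by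
    ext j; push_cast; ring
  rw [h', Matrix.det_vandermonde_add]
  cases d with
  | zero => simp
  | succ d =>
    rw [Matrix.det_vandermonde_id_eq_superFactorial, ← Nat.prod_range_succ_factorial]
    push_cast
    rfl

theorem intChoose_add_eq_descFactorial {n k : ℕ} (hk : k ≤ n) (i j : ℕ) :
    intChoose (n + j) (k - i + j) =
      ((n - k + i).factorial : ℚ)⁻¹ *
        (((n + j).factorial / (k + j).factorial : ℚ) * (k + j).descFactorial i) := by
  obtain h | h := lt_or_ge (k + j) i
  · rw [intChoose_of_neg _ (by omega), Nat.descFactorial_eq_zero_iff_lt.2 h]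
    simp
  · have ht : (k : ℤ) - i + j = (k + j - i : ℕ) := by omega
    have hd : (n + j) - (k + j - i) = n - k + i := by omega
    have hf := Nat.factorial_mul_descFactorial h
    rw [ht, intChoose_natCast, Nat.cast_choose ℚ (by omega), hd, ← hf]
    have := Nat.factorial_pos (k + j)
    rw [← hf] at this
    have h₁ := (Nat.pos_of_mul_pos_left this).ne'
    have h₂ := (Nat.pos_of_mul_pos_right this).ne'
    have h₃ := (n - k + i).factorial_ne_zero
    push_cast
    field_simp

/-- **Stanley's determinant evaluation** (via MacMahon's Master Theorem).
With `aₘ = binom(n,m)` for `0 ≤ m ≤ n` and `aₘ = 0` otherwise, for all `0 ≤ k ≤ n` the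
`d × d` determinant `D_k^{(d)} = det(a_{k-i+j})_{0 ≤ i,j ≤ d-1}` over `ℚ` equals
`∏_{j=0}^{d-1} binom(n+j, k+j) / binom(n-k+j, n-k)`. -/
theorem stanley_determinant (d n k : ℕ) (hk : k ≤ n) :
    Matrix.det (Matrix.of fun i j : Fin d =>
      if 0 ≤ (k : ℤ) - i + j then (n.choose ((k : ℤ) - i + j).toNat : ℚ) else 0) =
    ∏ j ∈ range d, ((n + j).choose (k + j) : ℚ) / ((n - k + j).choose (n - k) : ℚ) := by
  refine (det_intChoose_eq_det_intChoose_add d n k).trans ?_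
  simp only [intChoose_add_eq_descFactorial hk]
  have hcol := Matrix.det_mul_column (fun i : Fin d ↦ ((n - k + i).factorial : ℚ)⁻¹)
    (Matrix.of fun i j : Fin d ↦
      ((n + j).factorial / (k + j).factorial : ℚ) * ((k + j : ℕ).descFactorial i : ℚ))
  have hrow := Matrix.det_mul_row (fun j : Fin d ↦ ((n + j).factorial / (k + j).factorial : ℚ))
    (Matrix.of fun i j : Fin d ↦ ((k + j : ℕ).descFactorial i : ℚ))
  simp only [Matrix.of_apply] at hcol hrow
  rw [hcol, hrow, det_descFactorial,
    Fin.prod_univ_eq_prod_range (fun i ↦ ((n - k + i).factorial : ℚ)⁻¹),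
    Fin.prod_univ_eq_prod_range (fun j ↦ ((n + j).factorial / (k + j).factorial : ℚ)),
    ← prod_mul_distrib, ← prod_mul_distrib]
  refine prod_congr rfl fun j _ ↦ ?_
  rw [Nat.cast_choose ℚ (by omega : k + j ≤ n + j), Nat.cast_add_choose,
    Nat.add_sub_add_right]
  have h₁ := (n - k).factorial_ne_zero
  have h₂ := (n - k + j).factorial_ne_zero
  have h₃ := (k + j).factorial_ne_zero
  have h₄ := j.factorial_ne_zero
  field_simp
end

section
/- For natural numbers d and n, the real polynomial B(x) = sum_{k=0}^n binom(n,k) * (n+d)! * d! / ((k+d)! (n-k+d)!) * x^k has only real negative zeros. -/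
open Polynomial Finset

/-- A convex set containing the zeros of a complex polynomial contains the zeros of all its
iterated derivatives. -/
theorem Polynomial.rootSet_iterate_derivative_subset_of_convex {K : Set ℂ} (hK : Convex ℝ K)
    {P : ℂ[X]} (hP : P.rootSet ℂ ⊆ K) (m : ℕ) : (derivative^[m] P).rootSet ℂ ⊆ K := by
  induction m with
  | zero => simpa using hP
  | succ m ih =>
    rw [Function.iterate_succ_apply']
    by_cases h : 0 < (derivative^[m] P).degree
    · exact (rootSet_derivative_subset_convexHull_rootSet h).trans (convexHull_min ih hK)
    · rw [eq_C_of_degree_le_zero (not_lt.mp h)]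
      simp

/-- The coefficients of the polynomial `B`. -/
noncomputable def bCoeff (d n k : ℕ) : ℝ :=
  (n.choose k : ℝ) * (n + d).factorial * d.factorial /
    ((k + d).factorial * (n - k + d).factorial)

theorem bCoeff_pos {d n k : ℕ} (hk : k ≤ n) : 0 < bCoeff d n k := by
  have := Nat.choose_pos hk
  unfold bCoeff
  positivity

/-- The product rule coefficients of the derivative of order `n + 2 * d` of
`X ^ (n + d) * (X + 1) ^ (n + d)` are proportional to `bCoeff d n`. -/
theorem choose_mul_descFactorial_eq_bCoeff {d n k : ℕ} (hk : k ≤ n) :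
    (n.factorial * d.factorial * ((n + 2 * d).choose (d + k) *
      ((n + d).descFactorial (n + 2 * d - (d + k)) * (n + d).descFactorial (d + k))) : ℝ) =
      (n + 2 * d).factorial * (n + d).factorial * bCoeff d n k := by
  obtain ⟨l, rfl⟩ := Nat.exists_eq_add_of_le hk
  have h₁ : ((k + l + 2 * d).choose (d + k) : ℝ) =
      (k + l + 2 * d).factorial / ((k + d).factorial * (l + d).factorial) := by
    rw [Nat.cast_choose ℝ (by lia), show k + l + 2 * d - (d + k) = l + d by lia, add_comm d k]
  have h₂ : ((k + l + d).descFactorial (k + l + 2 * d - (d + k)) : ℝ) =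
      (k + l + d).factorial / k.factorial := by
    rw [eq_div_iff (by positivity), mul_comm]
    have := Nat.factorial_mul_descFactorial (show l + d ≤ k + l + d by lia)
    rw [show k + l + d - (l + d) = k by lia] at this
    rw [show k + l + 2 * d - (d + k) = l + d by lia]
    exact_mod_cast this
  have h₃ : ((k + l + d).descFactorial (d + k) : ℝ) =
      (k + l + d).factorial / l.factorial := by
    rw [eq_div_iff (by positivity), mul_comm]
    have := Nat.factorial_mul_descFactorial (show d + k ≤ k + l + d by lia)
    rw [show k + l + d - (d + k) = l by lia] at this
    exact_mod_cast this
  rw [h₁, h₂, h₃, bCoeff, Nat.cast_choose ℝ hk, Nat.add_sub_cancel_left]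
  field_simp

/-- A Rodrigues-type formula for the homogenization of `B` at `(t, t + 1)`. -/
theorem eval_iterate_derivative_eq_sum_bCoeff (d n : ℕ) (t : ℂ) :
    n.factorial * d.factorial *
      (derivative^[n + 2 * d] (X ^ (n + d) * (X + C 1) ^ (n + d) : ℂ[X])).eval t =
    (n + 2 * d).factorial * (n + d).factorial *
      ∑ k ∈ range (n + 1), (bCoeff d n k : ℂ) * (t ^ k * (t + 1) ^ (n - k)) := by
  rw [iterate_derivative_mul, show (n + 2 * d).succ = d + ((n + 1) + d) by lia,
    sum_range_add, sum_range_add, sum_eq_zero (s := range d), zero_add, add_comm,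
    sum_eq_zero (s := range d), zero_add, eval_finsetSum, mul_sum, mul_sum]
  · refine sum_congr rfl fun k hk ↦ ?_
    have hk : k ≤ n := Nat.lt_succ_iff.mp (mem_range.mp hk)
    have h := congrArg (Complex.ofReal) (choose_mul_descFactorial_eq_bCoeff (d := d) hk)
    push_cast at h
    rw [iterate_derivative_X_pow_eq_natCast_mul, iterate_derivative_X_add_pow,
      ← mul_assoc _ _ (_ * _), ← h,
      show n + d - (n + 2 * d - (d + k)) = k by lia, show n + d - (d + k) = n - k by lia]
    simp only [nsmul_eq_mul, eval_mul, eval_natCast, eval_pow, eval_X, eval_add, eval_C]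
    ring
  · intro j hj
    rw [iterate_derivative_X_add_pow, Nat.descFactorial_of_lt (by lia)]
    simp
  · intro j hj
    have := mem_range.mp hj
    rw [iterate_derivative_X_pow_eq_natCast_mul, Nat.descFactorial_of_lt (by lia)]
    simp

/-- For natural numbers `d` and `n`, the real polynomial
`B(x) = ∑_{k=0}^n binom(n,k) (n+d)! d! / ((k+d)! (n-k+d)!) xᵏ` has only real negative
zeros. -/
theorem B_real_negative_zeros (d n : ℕ) :
    ∀ z : ℂ,
      aeval z (∑ k ∈ range (n + 1),
          C ((n.choose k : ℝ) * (n + d).factorial * d.factorial /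
              ((k + d).factorial * (n - k + d).factorial)) * X ^ k) = 0 →
      ∃ x : ℝ, x < 0 ∧ (x : ℂ) = z := by
  intro z hz
  change aeval z (∑ k ∈ range (n + 1), C (bCoeff d n k) * X ^ k) = 0 at hz
  simp only [map_sum, map_mul, aeval_C, map_pow, aeval_X, Complex.coe_algebraMap] at hz
  have hb₀ : (bCoeff d n 0 : ℂ) ≠ 0 := by exact_mod_cast (bCoeff_pos n.zero_le).ne'
  have hz₀ : z ≠ 0 := by
    rintro rfl
    rw [sum_range_succ'] at hz
    simp [hb₀] at hz
  have hz₁ : 1 - z ≠ 0 := by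
    intro h
    obtain rfl := sub_eq_zero.mp h
    simp only [one_pow, mul_one] at hz
    refine (sum_pos (fun k hk ↦ ?_) nonempty_range_add_one).ne' (by exact_mod_cast hz)
    exact bCoeff_pos (Nat.lt_succ_iff.mp (mem_range.mp hk))
  set Q : ℂ[X] := derivative^[n + 2 * d] (X ^ (n + d) * (X + C 1) ^ (n + d)) with hQ
  have hfact : ∀ a b : ℕ, (a.factorial * b.factorial : ℂ) ≠ 0 := fun a b ↦ by
    exact_mod_cast (Nat.mul_pos a.factorial_pos b.factorial_pos).ne'
  have hQ₀ : Q ≠ 0 := by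
    intro h
    have := eval_iterate_derivative_eq_sum_bCoeff d n 0
    rw [← hQ, h, sum_range_succ'] at this
    simp [hb₀, Nat.factorial_ne_zero] at this
  have hroot : z / (1 - z) ∈ Q.rootSet ℂ := by
    rw [mem_rootSet, coe_aeval_eq_eval]
    refine ⟨hQ₀, (mul_eq_zero_iff_left (hfact n d)).mp ?_⟩
    rw [eval_iterate_derivative_eq_sum_bCoeff]
    have : ∑ k ∈ range (n + 1),
        (bCoeff d n k : ℂ) * ((z / (1 - z)) ^ k * (z / (1 - z) + 1) ^ (n - k)) =
        (∑ k ∈ range (n + 1), (bCoeff d n k : ℂ) * z ^ k) / (1 - z) ^ n := by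
      rw [sum_div]
      refine sum_congr rfl fun k hk ↦ ?_
      have hk : k ≤ n := Nat.lt_succ_iff.mp (mem_range.mp hk)
      rw [show z / (1 - z) + 1 = 1 / (1 - z) by field_simp; ring, div_pow, div_pow, one_pow,
        div_mul_div_comm, ← pow_add, Nat.add_sub_cancel' hk, mul_one, mul_div_assoc]
    rw [this, hz, zero_div, mul_zero]
  have hsub : Q.rootSet ℂ ⊆ segment ℝ (-1 : ℂ) 0 := by
    refine rootSet_iterate_derivative_subset_of_convex (convex_segment _ _) (fun w hw ↦ ?_) _
    rw [mem_rootSet, coe_aeval_eq_eval] at hw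
    have h := hw.2
    simp only [eval_mul, eval_pow, eval_X, eval_add, eval_C] at h
    rcases mul_eq_zero.mp h with h | h
    · rw [eq_zero_of_pow_eq_zero h]
      exact right_mem_segment _ _ _
    · rw [eq_neg_of_add_eq_zero_left (eq_zero_of_pow_eq_zero h)]
      exact left_mem_segment _ _ _
  obtain ⟨a, b, ha, hb, hab, ht⟩ := hsub hroot
  have hab' : (b : ℂ) = 1 - a := by
    rw [← Complex.ofReal_one, ← Complex.ofReal_sub, ← hab, add_sub_cancel_left]
  rw [smul_zero, add_zero, Complex.real_smul, eq_div_iff hz₁] at ht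
  have hbz : (b : ℂ) * z = -a := by
    rw [hab']
    linear_combination -ht
  have hb₁ : b ≠ 0 := by
    rintro rfl
    have : a = 0 := by simpa using hbz
    simp [this] at hab
  have ha₁ : a ≠ 0 := by
    rintro rfl
    simp [hb₁, hz₀] at hbz
  refine ⟨-a / b, div_neg_of_neg_of_pos (neg_lt_zero.mpr (ha.lt_of_ne' ha₁))
    (hb.lt_of_ne' hb₁), ?_⟩
  push_cast
  rw [← hbz, mul_div_cancel_left₀]
  exact_mod_cast hb₁
end

section
/- Let n be a natural number and let P be a finite set of natural numbers. Then the real polynomial sum_{k=0}^n binom(n,k) * [ prod_{alpha in P} binom(n+alpha, k+alpha) / binom(n-k+alpha, n-k) ] * x^k has only real negative zeros. (This polynomial is the hypergeometric polynomial _{|P|+1}F_{|P|}(-n, -(n+alpha_1), ..., -(n+alpha_{|P|}); alpha_1, ..., alpha_{|P|}; (-1)^{|P|+1} x) when the elements of P are positive.) -/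
open Polynomial Finset

/-- If all complex roots of `p` are real and `c` is a nonzero real, then all complex roots of
`derivative p - c p` are real. -/
lemma im_eq_zero_of_eval_derivative_sub {p : ℂ[X]} (hp : ∀ z, p.eval z = 0 → z.im = 0)
    {c : ℝ} (hc : c ≠ 0) {z : ℂ} (hz : (derivative p - C (c : ℂ) * p).eval z = 0) :
    z.im = 0 := by
  by_contra hzim
  have hpz : p.eval z ≠ 0 := fun h => hzim (hp z h)
  have hlog := (IsAlgClosed.splits p).eval_derivative_div_eval_of_ne_zero hpz
  have hquot : p.derivative.eval z / p.eval z = c := by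
    rw [div_eq_iff hpz]
    simpa [sub_eq_zero] using hz
  rw [hquot] at hlog
  have him : ∀ s : Multiset ℂ, (∀ r ∈ s, r.im = 0) →
      ∃ t : ℝ, 0 ≤ t ∧ (s ≠ 0 → 0 < t) ∧ ((s.map fun r => 1 / (z - r)).sum).im = -z.im * t := by
    intro s
    induction s using Multiset.induction with
    | empty => exact fun _ => ⟨0, by simp⟩
    | cons r s ih =>
      intro hs
      obtain ⟨t, ht, -, hst⟩ := ih fun q hq => hs q (Multiset.mem_cons_of_mem hq)
      have hr := hs r (Multiset.mem_cons_self r s)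
      have hzr : z - r ≠ 0 := by
        intro h
        rw [sub_eq_zero] at h
        exact hzim (h ▸ hr)
      have hpos : 0 < (Complex.normSq (z - r))⁻¹ := inv_pos.mpr (Complex.normSq_pos.mpr hzr)
      refine ⟨(Complex.normSq (z - r))⁻¹ + t, by positivity, fun _ => by positivity, ?_⟩
      rw [Multiset.map_cons, Multiset.sum_cons, Complex.add_im, hst, one_div, Complex.inv_im,
        Complex.sub_im, hr]
      ring
  obtain ⟨t, -, ht, hst⟩ := him p.roots fun r hr => hp r (isRoot_of_mem_roots hr)
  rw [← hlog, Complex.ofReal_im] at hst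
  by_cases hroots : p.roots = 0
  · simp [hroots, hc] at hlog
  · exact mul_ne_zero (neg_ne_zero.mpr hzim) (ht hroots).ne' hst.symm

/-- If all roots of `f` are real and nonzero and all roots of `p` are real, then all roots of
`f(D) p` are real, where `D` is differentiation. -/
lemma im_eq_zero_of_eval_aeval_derivative {f p : ℂ[X]}
    (hf : ∀ z, f.eval z = 0 → z.im = 0 ∧ z ≠ 0) (hp : ∀ z, p.eval z = 0 → z.im = 0)
    {z : ℂ} (hz : (aeval (derivative : ℂ[X] →ₗ[ℂ] ℂ[X]) f p).eval z = 0) : z.im = 0 := by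
  have hf0 : f ≠ 0 := by
    rintro rfl
    exact (hf 0 (by simp)).2 rfl
  have hprod : ∀ s : Multiset ℂ, (∀ r ∈ s, r.im = 0 ∧ r ≠ 0) → ∀ w,
      (aeval (derivative : ℂ[X] →ₗ[ℂ] ℂ[X]) (s.map fun r => X - C r).prod p).eval w = 0 →
        w.im = 0 := by
    intro s
    induction s using Multiset.induction with
    | empty => simpa using hp
    | cons r s ih =>
      intro hs w hw
      obtain ⟨hr, hr0⟩ := hs r (Multiset.mem_cons_self r s)
      have hre : ((r.re : ℝ) : ℂ) = r := Complex.ext rfl hr.symm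
      refine im_eq_zero_of_eval_derivative_sub
        (ih fun q hq => hs q (Multiset.mem_cons_of_mem hq)) (c := r.re) ?_ (z := w) ?_
      · intro h
        exact hr0 (Complex.ext h hr)
      · rw [hre, ← smul_eq_C_mul]
        simpa [Module.algebraMap_end_apply] using hw
  rw [(IsAlgClosed.splits f).eq_prod_roots, map_mul, aeval_C, Module.End.mul_apply,
    Module.algebraMap_end_apply, eval_smul, smul_eq_mul] at hz
  refine hprod f.roots (fun r hr => hf r (isRoot_of_mem_roots hr)) z ?_
  exact (mul_eq_zero.mp hz).resolve_left (leadingCoeff_ne_zero.mpr hf0)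

/-- The reversed sequence divided by shifted factorials generates a real-rooted polynomial
whenever the original positive sequence does. -/
lemma im_eq_zero_of_sum_reverse_div_factorial {n : ℕ} (α : ℕ) {a : ℕ → ℝ} (ha : ∀ k, 0 < a k)
    (hroot : ∀ z : ℂ, ∑ k ∈ range (n + 1), (a k : ℂ) * z ^ k = 0 → z.im = 0)
    {z : ℂ} (hz : ∑ k ∈ range (n + 1), ((a (n - k) / (k + α).factorial : ℝ) : ℂ) * z ^ k = 0) :
    z.im = 0 := by
  refine im_eq_zero_of_eval_aeval_derivative
    (f := ∑ k ∈ range (n + 1), C (a k : ℂ) * X ^ k) (p := X ^ (n + α)) ?_ ?_ ?_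
  · intro w hw
    rw [eval_finsetSum] at hw
    simp only [eval_mul, eval_C, eval_pow, eval_X] at hw
    refine ⟨hroot w hw, ?_⟩
    rintro rfl
    rw [sum_range_succ'] at hw
    simp [(ha 0).ne'] at hw
  · intro w hw
    have hw0 : w = 0 := by
      rw [eval_pow, eval_X] at hw
      exact eq_zero_of_pow_eq_zero hw
    simp [hw0]
  · have hsum : (aeval (derivative : ℂ[X] →ₗ[ℂ] ℂ[X])
        (∑ k ∈ range (n + 1), C (a k : ℂ) * X ^ k) (X ^ (n + α))).eval z =
        (n + α).factorial * z ^ α *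
          ∑ k ∈ range (n + 1), ((a (n - k) / (k + α).factorial : ℝ) : ℂ) * z ^ k := by
      rw [← sum_range_reflect (fun k => ((a (n - k) / (k + α).factorial : ℝ) : ℂ) * z ^ k),
        map_sum, LinearMap.sum_apply, eval_finsetSum, mul_sum]
      refine sum_congr rfl fun k hk => ?_
      have hkn : k ≤ n := Nat.lt_succ_iff.mp (mem_range.mp hk)
      have hfac := Nat.factorial_mul_descFactorial (show k ≤ n + α by omega)
      rw [map_mul, aeval_C, aeval_X_pow, Module.End.mul_apply, Module.algebraMap_end_apply,
        Module.End.pow_apply, iterate_derivative_X_pow_eq_natCast_mul, ← hfac,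
        show n + 1 - 1 - k = n - k by omega, show n - (n - k) = k by omega,
        show n + α - k = n - k + α by omega]
      have hne : ((n - k + α).factorial : ℂ) ≠ 0 := by exact_mod_cast Nat.factorial_ne_zero _
      simp only [eval_smul, eval_mul, eval_natCast, eval_pow, eval_X, smul_eq_mul]
      push_cast
      field_simp
      ring
    rw [hsum, hz, mul_zero]

lemma choose_div_choose_eq_factorial {n k : ℕ} (hk : k ≤ n) (α : ℕ) :
    ((n + α).choose (k + α) : ℝ) / ((n - k + α).choose (n - k) : ℝ) =
      (n + α).factorial * α.factorial * (1 / ((n - k + α).factorial * (k + α).factorial)) := by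
  rw [Nat.cast_choose ℝ (show k + α ≤ n + α by omega),
    Nat.cast_choose ℝ (show n - k ≤ n - k + α by omega),
    show n + α - (k + α) = n - k by omega, show n - k + α - (n - k) = α by omega]
  have h (m : ℕ) : (m.factorial : ℝ) ≠ 0 := by exact_mod_cast m.factorial_ne_zero
  have h₁ := h (n - k)
  have h₂ := h (n - k + α)
  have h₃ := h (k + α)
  have h₄ := h α
  field_simp

lemma im_eq_zero_of_sum_choose_mul_prod (n : ℕ) (P : Finset ℕ) {z : ℂ}
    (hz : ∑ k ∈ range (n + 1), (((n.choose k : ℝ) *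
      ∏ α ∈ P, ((n + α).choose (k + α) : ℝ) / ((n - k + α).choose (n - k) : ℝ) : ℝ) : ℂ)
        * z ^ k = 0) : z.im = 0 := by
  -- Off `range (n + 1)` the coefficients are replaced by positive junk.
  have key : ∀ P : Finset ℕ, ∃ a : ℕ → ℝ, (∀ k, 0 < a k) ∧
      (∀ k ≤ n, a k = (n.choose k : ℝ) *
        ∏ α ∈ P, (1 / ((n - k + α).factorial * (k + α).factorial) : ℝ)) ∧
      ∀ w : ℂ, ∑ k ∈ range (n + 1), (a k : ℂ) * w ^ k = 0 → w.im = 0 := by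
    intro P
    induction P using Finset.induction with
    | empty =>
      refine ⟨fun k => if k ≤ n then n.choose k else 1, fun k => ?_, fun k hk => by simp [hk],
        fun w hw => ?_⟩
      · dsimp only
        split_ifs with hk
        · exact_mod_cast Nat.choose_pos hk
        · exact one_pos
      · have hpow : (w + 1) ^ n = 0 := by
          rw [add_pow, ← hw]
          refine sum_congr rfl fun k hk => ?_
          simp [Nat.lt_succ_iff.mp (mem_range.mp hk), mul_comm]
        rw [eq_neg_of_add_eq_zero_left (eq_zero_of_pow_eq_zero hpow)]
        simp
    | insert α P hα ih =>
      obtain ⟨a, ha, hak, hroot⟩ := ih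
      have hfac (m : ℕ) : (0 : ℝ) < m.factorial := by exact_mod_cast m.factorial_pos
      refine ⟨fun k => a (n - (n - k)) / (n - k + α).factorial / (k + α).factorial,
        fun k => div_pos (div_pos (ha _) (hfac _)) (hfac _), fun k hk => ?_, fun w hw => ?_⟩
      · simp only [show n - (n - k) = k by omega]
        rw [hak k hk, prod_insert hα]
        have h₁ := (hfac (n - k + α)).ne'
        have h₂ := (hfac (k + α)).ne'
        field_simp
      · exact im_eq_zero_of_sum_reverse_div_factorial α
          (a := fun k => a (n - k) / (k + α).factorial) (fun k => div_pos (ha _) (hfac _))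
          (fun w hw => im_eq_zero_of_sum_reverse_div_factorial α ha hroot hw) hw
  obtain ⟨a, -, hak, hroot⟩ := key P
  refine hroot z ?_
  have hconst : (∏ α ∈ P, ((n + α).factorial * α.factorial : ℂ)) ≠ 0 :=
    prod_ne_zero_iff.mpr fun α _ => by
      exact_mod_cast mul_ne_zero (n + α).factorial_ne_zero α.factorial_ne_zero
  refine (mul_eq_zero.mp (Eq.trans ?_ hz)).resolve_left hconst
  rw [mul_sum]
  refine sum_congr rfl fun k hk => ?_
  have hkn : k ≤ n := Nat.lt_succ_iff.mp (mem_range.mp hk)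
  have hprod : ∏ α ∈ P, ((n + α).choose (k + α) : ℝ) / ((n - k + α).choose (n - k) : ℝ) =
      (∏ α ∈ P, ((n + α).factorial * α.factorial : ℝ)) *
        ∏ α ∈ P, (1 / ((n - k + α).factorial * (k + α).factorial) : ℝ) := by
    rw [← prod_mul_distrib]
    exact prod_congr rfl fun α _ => choose_div_choose_eq_factorial hkn α
  rw [hak k hkn, hprod, Complex.ofReal_mul, Complex.ofReal_mul, Complex.ofReal_mul,
    Complex.ofReal_prod P fun α => ((n + α).factorial * α.factorial : ℝ)]
  simp only [Complex.ofReal_mul, Complex.ofReal_natCast]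
  ring

/-- For `n : ℕ` and a finite set `P` of natural numbers, the hypergeometric polynomial
`∑_{k=0}^n binom(n,k) [∏_{α ∈ P} binom(n+α, k+α) / binom(n-k+α, n-k)] xᵏ` has only real
negative zeros. -/
theorem hypergeometric_real_negative_zeros (n : ℕ) (P : Finset ℕ) :
    ∀ z : ℂ,
      aeval z (∑ k ∈ range (n + 1),
          C ((n.choose k : ℝ) *
              ∏ α ∈ P, ((n + α).choose (k + α) : ℝ) / ((n - k + α).choose (n - k) : ℝ))
            * X ^ k) = 0 →
      ∃ x : ℝ, x < 0 ∧ (x : ℂ) = z := by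
  intro z hz
  have hsum : ∑ k ∈ range (n + 1), (((n.choose k : ℝ) *
      ∏ α ∈ P, ((n + α).choose (k + α) : ℝ) / ((n - k + α).choose (n - k) : ℝ) : ℝ) : ℂ)
        * z ^ k = 0 := by
    rw [← hz, map_sum]
    refine sum_congr rfl fun k _ => ?_
    rw [map_mul, aeval_C, map_pow, aeval_X]
    rfl
  have hre : ((z.re : ℝ) : ℂ) = z :=
    Complex.ext rfl (im_eq_zero_of_sum_choose_mul_prod n P hsum).symm
  refine ⟨z.re, ?_, hre⟩
  by_contra! hnonneg
  rw [← hre] at hsum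
  norm_cast at hsum
  refine hsum.not_gt (sum_pos' (fun k _ => by positivity) ⟨0, by simp, ?_⟩)
  have hprod : 0 < ∏ α ∈ P, ((n + α).choose (0 + α) : ℝ) / ((n - 0 + α).choose (n - 0) : ℝ) :=
    prod_pos fun α _ => div_pos (by exact_mod_cast Nat.choose_pos (by omega))
      (by exact_mod_cast Nat.choose_pos (by omega))
  simpa using hprod
end

section
/- Let d >= 1 and k be natural numbers, and consider the d-by-d real matrix A with entries A_{ij} = 1/(k-i+j)! for 0 <= i, j <= d-1, where by convention 1/m! = 0 for m < 0. Then det(A) = prod_{j=0}^{d-1} j! / (k+j)!. -/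
open Finset

/-- The reciprocal factorial `1/(n-i)!`, taken to be `0` when `n < i`, is the falling factorial
`n (n-1) ⋯ (n-i+1)` divided by `n!`. -/
lemma ite_one_div_factorial_sub_eq (n i : ℕ) :
    (if 0 ≤ (n : ℤ) - i then (1 : ℝ) / (((n : ℤ) - i).toNat.factorial : ℝ) else 0) =
      (1 / (n.factorial : ℝ)) * (descPochhammer ℝ i).eval (n : ℝ) := by
  rw [descPochhammer_eval_eq_descFactorial]
  split_ifs with h
  · have hi : i ≤ n := by omega
    have hn : ((n : ℤ) - i).toNat = n - i := by omega
    rw [hn, ← Nat.factorial_mul_descFactorial hi, Nat.cast_mul]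
    have hd : (n.descFactorial i : ℝ) ≠ 0 := by
      exact_mod_cast (Nat.descFactorial_pos.2 hi).ne'
    field_simp
  · rw [Nat.descFactorial_of_lt (by omega)]
    simp

/-- The determinant of the falling factorials of `d` consecutive natural numbers. -/
lemma det_descPochhammer_eval_add (d k : ℕ) :
    (Matrix.of fun j i : Fin d => (descPochhammer ℝ i).eval ((k + j : ℕ) : ℝ)).det =
      ∏ j ∈ range d, (j.factorial : ℝ) := by
  have h := Matrix.det_eval_matrixOfPolynomials_eq_det_vandermonde
    (fun j : Fin d => ((j : ℕ) : ℝ) + k) (fun i => descPochhammer ℝ i)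
    (fun i => descPochhammer_natDegree ℝ i) (fun i => monic_descPochhammer ℝ i)
  rw [Matrix.det_vandermonde_add] at h
  simp only [Nat.cast_add, add_comm (k : ℝ)]
  rw [← h]
  cases d with
  | zero => simp
  | succ n =>
    rw [Matrix.det_vandermonde_id_eq_superFactorial, ← Nat.prod_range_succ_factorial, Nat.cast_prod]

/-- For `d ≥ 1` and `k : ℕ`, the `d × d` real matrix `A` with entries
`A i j = 1/(k-i+j)!` (with `1/m! = 0` for `m < 0`) has determinant
`∏_{j=0}^{d-1} j! / (k+j)!`. -/
theorem exp_toeplitz_determinant (d k : ℕ) (hd : 1 ≤ d) :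
    Matrix.det (Matrix.of fun i j : Fin d =>
      if 0 ≤ (k : ℤ) - i + j then (1 : ℝ) / (((k : ℤ) - i + j).toNat.factorial : ℝ) else 0) =
    ∏ j ∈ range d, (j.factorial : ℝ) / ((k + j).factorial : ℝ) := by
  rw [← Matrix.det_transpose]
  have hA : (Matrix.of fun i j : Fin d => if 0 ≤ (k : ℤ) - i + j then
      (1 : ℝ) / (((k : ℤ) - i + j).toNat.factorial : ℝ) else 0).transpose =
      Matrix.of fun j i : Fin d => (1 / ((k + j).factorial : ℝ)) *
        (Matrix.of fun j i : Fin d => (descPochhammer ℝ i).eval ((k + j : ℕ) : ℝ)) j i := by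
    ext j i
    have hkj : (k : ℤ) - i + j = ((k + j : ℕ) : ℤ) - (i : ℕ) := by push_cast; ring
    simp only [Matrix.transpose_apply, Matrix.of_apply, hkj]
    exact ite_one_div_factorial_sub_eq (k + j) i
  rw [hA, Matrix.det_mul_column, det_descPochhammer_eval_add,
    Fin.prod_univ_eq_prod_range (fun j => 1 / ((k + j).factorial : ℝ)) d, ← prod_mul_distrib]
  exact prod_congr rfl fun j _ => by ring
end

section
/- Fix a natural number d >= 1. For every natural number n, the real polynomial sum_{k=0}^n binom(n,k) * k! * [ prod_{j=0}^{d-1} j!/(k+j)! ] * x^k has only real negative zeros. (By the Polya-Schur characterization, this is equivalent to the statement that the entire function F_d[e^x] = sum_{k>=0} [ prod_{j=0}^{d-1} j!/(k+j)! ] x^k belongs to the Laguerre-Polya class L-P^+.) -/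
open Polynomial Finset

namespace Polynomial

/-- A nonzero linear differential operator `D - a`, with `a` real, preserves real-rootedness. -/
theorem im_eq_zero_of_eval_derivative_sub_C_mul {p : ℂ[X]} (hp : ∀ z, p.eval z = 0 → z.im = 0)
    {a : ℂ} (ha : a.im = 0) (ha0 : a ≠ 0) (z : ℂ)
    (hz : (derivative p - C a * p).eval z = 0) : z.im = 0 := by
  by_contra hzi
  have hpz : p.eval z ≠ 0 := fun h ↦ hzi (hp z h)
  have hdiv : (derivative p).eval z / p.eval z = a := by
    rw [div_eq_iff hpz, ← sub_eq_zero]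
    simpa using hz
  rw [(IsAlgClosed.splits p).eval_derivative_div_eval_of_ne_zero hpz] at hdiv
  have him (s : Multiset ℂ) (hs : ∀ x ∈ s, x.im = 0) :
      (s.map fun x ↦ 1 / (z - x)).sum.im =
        -z.im * (s.map fun x ↦ (Complex.normSq (z - x))⁻¹).sum := by
    induction s using Multiset.induction_on with
    | empty => simp
    | cons x s ih =>
      have hx := hs x (Multiset.mem_cons_self x s)
      have ih := ih fun y hy ↦ hs y (Multiset.mem_cons_of_mem hy)
      rw [Multiset.map_cons, Multiset.sum_cons, Complex.add_im, ih, one_div, Complex.inv_im,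
        Complex.sub_im, hx, Multiset.map_cons, Multiset.sum_cons]
      ring
  have hroots : ∀ x ∈ p.roots, x.im = 0 := fun x hx ↦ hp x (isRoot_of_mem_roots hx)
  have hsum := him p.roots hroots
  rw [hdiv, ha] at hsum
  have hzero : (p.roots.map fun x ↦ (Complex.normSq (z - x))⁻¹).sum = 0 := by
    simpa [hzi] using hsum.symm
  rcases Multiset.empty_or_exists_mem p.roots with h | ⟨x, hx⟩
  · simp [h] at hdiv
    exact ha0 hdiv.symm
  · have hle : (Complex.normSq (z - x))⁻¹ ≤
        (p.roots.map fun x ↦ (Complex.normSq (z - x))⁻¹).sum := by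
      refine Multiset.single_le_sum ?_ _ (Multiset.mem_map_of_mem _ hx)
      simp only [Multiset.mem_map]
      rintro _ ⟨y, -, rfl⟩
      exact inv_nonneg.2 (Complex.normSq_nonneg _)
    have hzx : z - x ≠ 0 := fun h ↦ hzi (by rw [sub_eq_zero.1 h]; exact hroots x hx)
    have := inv_pos.2 (Complex.normSq_pos.2 hzx)
    linarith

/-- If `q` is real-rooted and `q(0) ≠ 0`, then `q(D)` preserves real-rootedness. -/
theorem im_eq_zero_of_eval_aeval_derivative {q p : ℂ[X]} (hq : ∀ z, q.eval z = 0 → z.im = 0)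
    (hq0 : q.eval 0 ≠ 0) (hp : ∀ z, p.eval z = 0 → z.im = 0) (z : ℂ)
    (hz : (aeval (derivative : ℂ[X] →ₗ[ℂ] ℂ[X]) q p).eval z = 0) : z.im = 0 := by
  have hprod (s : Multiset ℂ) (hs : ∀ a ∈ s, a.im = 0 ∧ a ≠ 0) : ∀ w,
      (aeval (derivative : ℂ[X] →ₗ[ℂ] ℂ[X]) (s.map fun a ↦ X - C a).prod p).eval w = 0 →
        w.im = 0 := by
    induction s using Multiset.induction_on with
    | empty => simpa using hp
    | cons a s ih =>
      have ih := ih fun b hb ↦ hs b (Multiset.mem_cons_of_mem hb)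
      obtain ⟨ha, ha0⟩ := hs a (Multiset.mem_cons_self a s)
      intro w hw
      refine im_eq_zero_of_eval_derivative_sub_C_mul ih ha ha0 w ?_
      rw [Multiset.map_cons, Multiset.prod_cons, map_mul, Module.End.mul_apply] at hw
      simpa [Module.algebraMap_end_apply, smul_eq_C_mul] using hw
  have hq' : q ≠ 0 := by rintro rfl; simp at hq0
  refine hprod q.roots (fun a ha ↦ ⟨hq a (isRoot_of_mem_roots ha), ?_⟩) z ?_
  · rintro rfl
    exact hq0 (isRoot_of_mem_roots ha)
  · rw [(IsAlgClosed.splits q).eq_prod_roots, map_mul, Module.End.mul_apply] at hz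
    simpa [Module.algebraMap_end_apply, hq'] using hz

/-- The sequence `c / (k + j)!` multiplies real-rooted polynomials to real-rooted polynomials. -/
theorem im_eq_zero_of_sum_div_factorial {n : ℕ} {f : ℕ → ℂ} (hfn : f n ≠ 0)
    (hf : ∀ z : ℂ, ∑ k ∈ range (n + 1), f k * z ^ k = 0 → z.im = 0) (j : ℕ) (z : ℂ)
    (hz : ∑ k ∈ range (n + 1), f k / ((k + j).factorial : ℂ) * z ^ k = 0) : z.im = 0 := by
  have hfac (m : ℕ) : (m.factorial : ℂ) ≠ 0 := Nat.cast_ne_zero.2 m.factorial_ne_zero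
  set q : ℂ[X] := ∑ k ∈ range (n + 1), C (f k) * X ^ (n - k) with hqdef
  have hq0 : q.eval 0 ≠ 0 := by
    rw [hqdef, eval_finsetSum, sum_eq_single_of_mem n (by simp)]
    · simpa using hfn
    · intro k hk hkn
      have : n - k ≠ 0 := by have := mem_range.1 hk; lia
      simp [this]
  have hq (w : ℂ) (hw : q.eval w = 0) : w.im = 0 := by
    have hw0 : w ≠ 0 := by rintro rfl; exact hq0 hw
    have hinv : (w⁻¹).im = 0 := by
      apply hf
      have : ∑ k ∈ range (n + 1), f k * w⁻¹ ^ k = (w ^ n)⁻¹ * q.eval w := by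
        rw [hqdef, eval_finsetSum, mul_sum]
        refine sum_congr rfl fun k hk ↦ ?_
        have hk : k ≤ n := by have := mem_range.1 hk; lia
        have : w ^ n = w ^ k * w ^ (n - k) := by rw [← pow_add]; congr 1; lia
        simp only [eval_mul, eval_C, eval_pow, eval_X, this, inv_pow]
        field_simp
      rw [this, hw, mul_zero]
    simpa [Complex.inv_im, hw0] using hinv
  refine im_eq_zero_of_eval_aeval_derivative (p := X ^ (n + j)) hq hq0 ?_ z ?_
  · intro w hw
    rw [eval_pow, eval_X] at hw
    simp [eq_zero_of_pow_eq_zero hw]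
  · have : (aeval (derivative : ℂ[X] →ₗ[ℂ] ℂ[X]) q (X ^ (n + j))).eval z =
        ((n + j).factorial : ℂ) * z ^ j *
          ∑ k ∈ range (n + 1), f k / ((k + j).factorial : ℂ) * z ^ k := by
      rw [hqdef, map_sum, LinearMap.sum_apply, eval_finsetSum, mul_sum]
      refine sum_congr rfl fun k hk ↦ ?_
      have hk : k ≤ n := by have := mem_range.1 hk; lia
      have hsub : n + j - (n - k) = k + j := by lia
      have hdesc := Nat.factorial_mul_descFactorial (n := n + j) (k := n - k) (by lia)
      rw [hsub] at hdesc
      have hdesc : ((k + j).factorial : ℂ) * ((n + j).descFactorial (n - k) : ℂ) =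
        ((n + j).factorial : ℂ) := by exact_mod_cast hdesc
      simp only [map_mul, map_pow, aeval_C, aeval_X, Module.End.mul_apply, Module.End.pow_apply,
        Module.algebraMap_end_apply, iterate_derivative_X_pow_eq_smul, hsub, eval_smul, eval_pow,
        eval_X, smul_eq_mul, ← hdesc]
      have := hfac (k + j)
      field_simp
      ring
    rw [this, hz, mul_zero]

end Polynomial

/-- Fix `d ≥ 1`.  For every `n`, the real polynomial
`∑_{k=0}^n binom(n,k) · k! · [∏_{j=0}^{d-1} j!/(k+j)!] xᵏ` has only real negative zeros.
(By the Pólya–Schur characterization, this is equivalent to `F_d[eˣ] ∈ 𝓛-𝓟⁺`.) -/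
theorem Fd_exp_jensen_real_negative_zeros (d : ℕ) (hd : 1 ≤ d) (n : ℕ) :
    ∀ z : ℂ,
      aeval z (∑ k ∈ range (n + 1),
          C ((n.choose k : ℝ) * k.factorial *
              ∏ j ∈ range d, (j.factorial : ℝ) / ((k + j).factorial : ℝ)) * X ^ k) = 0 →
      ∃ x : ℝ, x < 0 ∧ (x : ℂ) = z := by
  have hfac (m : ℕ) : (0 : ℝ) < m.factorial := Nat.cast_pos.2 m.factorial_pos
  set f : ℕ → ℕ → ℝ := fun d k ↦ (n.choose k : ℝ) * k.factorial *
    ∏ j ∈ range d, (j.factorial : ℝ) / ((k + j).factorial : ℝ) with hfdef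
  have hpos (d k : ℕ) (hk : k ≤ n) : 0 < f d k := by
    have : (0 : ℝ) < n.choose k := Nat.cast_pos.2 (Nat.choose_pos hk)
    exact mul_pos (mul_pos this (hfac k)) (prod_pos fun j _ ↦ div_pos (hfac j) (hfac _))
  have hsucc (d k : ℕ) : f (d + 1) k = f d k * (d.factorial / (k + d).factorial) := by
    simp only [hfdef, prod_range_succ, mul_assoc]
  have him : ∀ z : ℂ, ∑ k ∈ range (n + 1), (f d k : ℂ) * z ^ k = 0 → z.im = 0 := by
    induction d, hd using Nat.le_induction with
    | base =>
      intro z hz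
      have h : ∑ k ∈ range (n + 1), (f 1 k : ℂ) * z ^ k = (z + 1) ^ n := by
        rw [add_pow]
        refine sum_congr rfl fun k _ ↦ ?_
        have : (k.factorial : ℂ) ≠ 0 := Nat.cast_ne_zero.2 k.factorial_ne_zero
        simp [hfdef, this, mul_comm]
      rw [h] at hz
      simp [eq_neg_of_add_eq_zero_left (eq_zero_of_pow_eq_zero hz)]
    | succ d _ ih =>
      intro z hz
      refine im_eq_zero_of_sum_div_factorial (f := fun k ↦ (f d k : ℂ))
        (Complex.ofReal_ne_zero.2 (hpos d n le_rfl).ne') ih d z ?_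
      have h : ∑ k ∈ range (n + 1), (f (d + 1) k : ℂ) * z ^ k = d.factorial *
          ∑ k ∈ range (n + 1), (f d k : ℂ) / ((k + d).factorial : ℂ) * z ^ k := by
        rw [mul_sum]
        refine sum_congr rfl fun k _ ↦ ?_
        rw [hsucc]
        push_cast
        ring
      rw [h] at hz
      exact (mul_eq_zero.1 hz).resolve_left (Nat.cast_ne_zero.2 d.factorial_ne_zero)
  intro z hz
  have hz : ∑ k ∈ range (n + 1), (f d k : ℂ) * z ^ k = 0 := by
    rw [map_sum] at hz
    simpa [hfdef] using hz
  have hre : (z.re : ℂ) = z := Complex.ext (by simp) (by simp [him z hz])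
  refine ⟨z.re, ?_, hre⟩
  by_contra! hnonneg
  rw [← hre] at hz
  have hz : ∑ k ∈ range (n + 1), f d k * z.re ^ k = 0 := by exact_mod_cast hz
  have hle (k : ℕ) (hk : k ∈ range (n + 1)) : 0 ≤ f d k * z.re ^ k :=
    mul_nonneg (hpos d k (Nat.lt_succ_iff.1 (mem_range.1 hk))).le (pow_nonneg hnonneg k)
  have h0 := (sum_eq_zero_iff_of_nonneg hle).1 hz 0 (by simp)
  simp [(hpos d 0 n.zero_le).ne'] at h0
end

section
/- For every natural number n >= 1, the real polynomial J[(1+x)^n](x) = sum_{k=0}^n [ 4( binom(n,k)^2 - binom(n,k-1) binom(n,k+1) )( binom(n,k+1)^2 - binom(n,k) binom(n,k+2) ) - ( binom(n,k) binom(n,k+1) - binom(n,k-1) binom(n,k+2) )^2 ] x^k has nonnegative coefficients and only real negative zeros, where binom(n,j) = 0 for j < 0 or j > n. -/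
open Polynomial Finset

/-- If every root of `g` is real and `r ≠ 0` is real, then `derivative g - r g`
has only real roots. -/
theorem im_eq_zero_of_isRoot_derivative_sub {g : ℂ[X]} (hg : ∀ z, g.eval z = 0 → z.im = 0)
    {r : ℂ} (hr : r.im = 0) (hr0 : r ≠ 0) (z : ℂ) (hz : (derivative g - C r * g).eval z = 0) :
    z.im = 0 := by
  by_contra hy
  have hgz : g.eval z ≠ 0 := fun h => hy (hg z h)
  have hlog : (g.roots.map fun w => 1 / (z - w)).sum = r := by
    rw [← (IsAlgClosed.splits g).eval_derivative_div_eval_of_ne_zero hgz, div_eq_iff hgz]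
    simpa [sub_eq_zero] using hz
  have hterm : ∀ w ∈ g.roots, (1 / (z - w)).im = z.im * -(Complex.normSq (z - w))⁻¹ := by
    intro w hw
    have hw' : w.im = 0 := hg w (isRoot_of_mem_roots hw)
    rw [one_div, Complex.inv_im, Complex.sub_im, hw']
    ring
  have him : z.im * (g.roots.map fun w => -(Complex.normSq (z - w))⁻¹).sum = 0 := by
    rw [← Multiset.sum_map_mul_left, ← Multiset.map_congr rfl hterm, ← hr, ← hlog]
    simpa using (map_multiset_sum Complex.imAddGroupHom (g.roots.map fun w => 1 / (z - w))).symm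
  have hsum : (g.roots.map fun w => (Complex.normSq (z - w))⁻¹).sum = 0 := by
    simpa [hy] using him
  by_cases hroots : g.roots = 0
  · rw [hroots] at hlog
    exact hr0 (by simpa using hlog.symm)
  · obtain ⟨w, hw⟩ := Multiset.exists_mem_of_ne_zero hroots
    have hle : (Complex.normSq (z - w))⁻¹ ≤
        (g.roots.map fun w => (Complex.normSq (z - w))⁻¹).sum := by
      refine Multiset.single_le_sum ?_ _ (Multiset.mem_map_of_mem _ hw)
      intro x hx
      obtain ⟨v, -, rfl⟩ := Multiset.mem_map.1 hx
      exact inv_nonneg.2 (Complex.normSq_nonneg _)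
    have hzw : z - w ≠ 0 := by
      intro h
      rw [sub_eq_zero.1 h] at hy
      exact hy (hg w (isRoot_of_mem_roots hw))
    have := inv_pos.2 (Complex.normSq_pos.2 hzw)
    linarith

/-- Hermite–Poulain: if `f` has only real nonzero roots and `g` only real roots, then `f(D) g`
has only real roots. -/
theorem im_eq_zero_of_isRoot_aeval_derivative {f : ℂ[X]} (hf0 : f ≠ 0)
    (hf : ∀ z, f.eval z = 0 → z.im = 0 ∧ z ≠ 0) {g : ℂ[X]}
    (hg : ∀ z, g.eval z = 0 → z.im = 0) (z : ℂ)
    (hz : ((aeval (derivative : Module.End ℂ ℂ[X]) f) g).eval z = 0) : z.im = 0 := by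
  have key : ∀ s : Multiset ℂ, (∀ r ∈ s, r.im = 0 ∧ r ≠ 0) → ∀ z,
      ((aeval (derivative : Module.End ℂ ℂ[X]) (s.map fun r => X - C r).prod) g).eval z = 0 →
        z.im = 0 := by
    intro s
    induction s using Multiset.induction_on with
    | empty => simpa using hg
    | cons r s ih =>
      intro hs z hz
      obtain ⟨hr, hr0⟩ := hs r (Multiset.mem_cons_self r s)
      refine im_eq_zero_of_isRoot_derivative_sub
        (ih fun t ht => hs t (Multiset.mem_cons_of_mem ht)) hr hr0 z ?_
      simpa [Module.algebraMap_end_apply, smul_eq_C_mul] using hz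
  refine key f.roots (fun r hr => hf r (isRoot_of_mem_roots hr)) z ?_
  rw [(IsAlgClosed.splits f).eq_prod_roots] at hz
  simpa [hf0, Module.algebraMap_end_apply] using hz

/-- The polynomial `∑_{k ≤ m} a_k x^k` has positive coefficients and only real zeros. -/
def IsPosRealRooted (m : ℕ) (a : ℕ → ℝ) : Prop :=
  (∀ k ≤ m, 0 < a k) ∧
    ∀ z : ℂ, ∑ k ∈ range (m + 1), (a k : ℂ) * z ^ k = 0 → z.im = 0

namespace IsPosRealRooted

theorem choose (m : ℕ) : IsPosRealRooted m fun k => m.choose k := by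
  refine ⟨fun k hk => Nat.cast_pos.2 (Nat.choose_pos hk), fun z hz => ?_⟩
  have h : (z + 1) ^ m = 0 := by
    rw [add_pow, ← hz]
    exact sum_congr rfl fun k _ => by simp [mul_comm]
  rw [eq_neg_of_add_eq_zero_left (eq_zero_of_pow_eq_zero h)]
  simp

theorem reflect_div_factorial {m : ℕ} {a : ℕ → ℝ} (ha : IsPosRealRooted m a) (s : ℕ) :
    IsPosRealRooted m fun k => a (m - k) / (k + s).factorial := by
  obtain ⟨hpos, hroot⟩ := ha
  refine ⟨fun k _ => div_pos (hpos _ (Nat.sub_le m k)) (by positivity), fun z hz => ?_⟩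
  set f : ℂ[X] := ∑ k ∈ range (m + 1), C (a k : ℂ) * X ^ k with hfdef
  have hfeval : ∀ w, f.eval w = ∑ k ∈ range (m + 1), (a k : ℂ) * w ^ k := by
    intro w
    simp [hfdef, eval_finsetSum]
  have hf_zero : f.eval 0 ≠ 0 := by
    rw [hfeval, sum_range_succ']
    simpa using (hpos 0 m.zero_le).ne'
  refine im_eq_zero_of_isRoot_aeval_derivative (f := f) (g := X ^ (m + s))
    (fun h => hf_zero (by simp [h])) (fun w hw => ⟨hroot w (hfeval w ▸ hw), ?_⟩) ?_ z ?_
  · rintro rfl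
    exact hf_zero hw
  · intro w hw
    rw [eval_pow, eval_X] at hw
    simp [eq_zero_of_pow_eq_zero hw]
  · have hterm : ((aeval (derivative : Module.End ℂ ℂ[X]) f) (X ^ (m + s))).eval z =
        ∑ k ∈ range (m + 1), (a k : ℂ) * (((m + s).descFactorial k : ℂ) * z ^ (m + s - k)) := by
      simp [hfdef, LinearMap.sum_apply, eval_finsetSum, Module.algebraMap_end_apply,
        Module.End.pow_apply, iterate_derivative_X_pow_eq_natCast_mul]
    rw [hterm, ← sum_range_reflect]
    have hsum : ∑ k ∈ range (m + 1), ((m + s).factorial * z ^ s) *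
        (((a (m - k) / (k + s).factorial : ℝ) : ℂ) * z ^ k) = 0 := by
      rw [← mul_sum, hz, mul_zero]
    rw [← hsum]
    refine sum_congr rfl fun k hk => ?_
    have hkm : k ≤ m := Nat.lt_succ_iff.1 (mem_range.1 hk)
    have hidx : m + 1 - 1 - k = m - k := by omega
    have hexp : m + s - (m - k) = s + k := by omega
    have hfac : ((m + s).factorial : ℂ) =
        (k + s).factorial * (m + s).descFactorial (m - k) := by
      rw [← Nat.factorial_mul_descFactorial (show m - k ≤ m + s by omega), hexp, add_comm s k]
      push_cast
      rfl
    have hne : ((k + s).factorial : ℂ) ≠ 0 := by exact_mod_cast (k + s).factorial_ne_zero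
    rw [hidx, hexp, hfac, pow_add]
    push_cast
    field_simp

theorem div_factorial {m : ℕ} {a : ℕ → ℝ} (ha : IsPosRealRooted m a) (s : ℕ) :
    IsPosRealRooted m fun k => a k / ((k + s).factorial * (m - k + s).factorial) := by
  obtain ⟨hpos, hroot⟩ := (ha.reflect_div_factorial s).reflect_div_factorial s
  have heq : ∀ k ≤ m, a (m - (m - k)) / (m - k + s).factorial / (k + s).factorial =
      a k / ((k + s).factorial * (m - k + s).factorial) := by
    intro k hk
    rw [Nat.sub_sub_self hk, div_div, mul_comm]
  refine ⟨fun k hk => (hpos k hk).trans_eq (heq k hk), fun z hz => hroot z ?_⟩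
  rw [← hz]
  refine sum_congr rfl fun k hk => ?_
  simp only [heq k (Nat.lt_succ_iff.1 (mem_range.1 hk))]

theorem exists_neg {m : ℕ} {a : ℕ → ℝ} (ha : IsPosRealRooted m a) {z : ℂ}
    (hz : ∑ k ∈ range (m + 1), (a k : ℂ) * z ^ k = 0) : ∃ x : ℝ, x < 0 ∧ (x : ℂ) = z := by
  have hre : (z.re : ℂ) = z := Complex.ext rfl (by simp [ha.2 z hz])
  refine ⟨z.re, not_le.1 fun hx => ?_, hre⟩
  rw [← hre] at hz
  have hz' : ∑ k ∈ range (m + 1), a k * z.re ^ k = 0 := by exact_mod_cast hz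
  have h0 : a 0 * z.re ^ 0 ≤ ∑ k ∈ range (m + 1), a k * z.re ^ k :=
    single_le_sum (f := fun k => a k * z.re ^ k)
      (fun k hk => mul_nonneg (ha.1 k (Nat.lt_succ_iff.1 (mem_range.1 hk))).le
        (pow_nonneg hx k)) (mem_range.2 m.succ_pos)
  have := ha.1 0 m.zero_le
  simp only [pow_zero, mul_one] at h0
  linarith

end IsPosRealRooted

/-- The higher order Turán expression of four consecutive terms with binomial-type ratios
between neighbours. -/
theorem turan_expression_eq {k j A B D E : ℝ} (hk : 0 ≤ k) (hj : 0 ≤ j)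
    (hA : A * (j + 2) = B * k) (hD : D * (k + 1) = B * (j + 1)) (hE : E * (k + 2) = D * j) :
    4 * (B ^ 2 - A * D) * (D ^ 2 - B * E) - (B * D - A * E) ^ 2 =
      4 * (k + j + 2) ^ 2 * (k + j + 3) * B ^ 4 * (j + 1) /
        ((k + 1) ^ 3 * (k + 2) ^ 2 * (j + 2) ^ 2) := by
  have h1 : k + 1 ≠ 0 := by positivity
  have h2 : k + 2 ≠ 0 := by positivity
  have h3 : j + 2 ≠ 0 := by positivity
  obtain rfl : A = B * k / (j + 2) := by rw [eq_div_iff h3, hA]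
  obtain rfl : D = B * (j + 1) / (k + 1) := by rw [eq_div_iff h1, hD]
  obtain rfl : E = B * (j + 1) / (k + 1) * j / (k + 2) := by rw [eq_div_iff h2, hE]
  field_simp
  ring

theorem turan_choose_eq (k j : ℕ) {A B D E : ℝ} (hB : B = (k + j + 1).choose k)
    (hA : A * (j + 2) = B * k) (hD : D * (k + 1) = B * (j + 1)) (hE : E * (k + 2) = D * j) :
    4 * (B ^ 2 - A * D) * (D ^ 2 - B * E) - (B * D - A * E) ^ 2 =
      4 * (k + j + 2) ^ 2 * (k + j + 3) * (k + j + 1).factorial ^ 4 / (k + j).factorial *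
        ((k + j).choose k / ((k + 1).factorial * (j + 1).factorial) /
          ((k + 2).factorial * (j + 2).factorial) /
          ((k + 2).factorial * (j + 2).factorial)) := by
  rw [turan_expression_eq k.cast_nonneg j.cast_nonneg hA hD hE, hB, add_assoc k j 1,
    Nat.cast_add_choose, Nat.cast_add_choose]
  have hk := Nat.cast_ne_zero (R := ℝ).2 k.factorial_ne_zero
  have hj := Nat.cast_ne_zero (R := ℝ).2 j.factorial_ne_zero
  have hkj := Nat.cast_ne_zero (R := ℝ).2 (k + j).factorial_ne_zero
  simp only [Nat.factorial_succ, Nat.cast_mul, Nat.cast_add, Nat.cast_one]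
  field_simp
  ring

theorem J_binomial_real_negative_zeros (n : ℕ) (hn : 1 ≤ n) :
    let b : ℤ → ℝ := fun j => if 0 ≤ j then (n.choose j.toNat : ℝ) else 0
    let p := ∑ k ∈ range (n + 1),
      C (4 * ((b k) ^ 2 - b ((k : ℤ) - 1) * b ((k : ℤ) + 1)) *
            ((b ((k : ℤ) + 1)) ^ 2 - b k * b ((k : ℤ) + 2)) -
          (b k * b ((k : ℤ) + 1) - b ((k : ℤ) - 1) * b ((k : ℤ) + 2)) ^ 2) * X ^ k
    (∀ k, 0 ≤ p.coeff k) ∧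
      ∀ z : ℂ, aeval z p = 0 → ∃ x : ℝ, x < 0 ∧ (x : ℂ) = z := by
  intro b p
  obtain ⟨m, rfl⟩ : ∃ m, n = m + 1 := ⟨n - 1, by omega⟩
  have hb : ∀ i : ℕ, b i = (m + 1).choose i := fun i => by simp [b]
  have hb_succ : ∀ i : ℕ, b (i + 1) = (m + 1).choose (i + 1) := fun i => by
    exact_mod_cast hb (i + 1)
  have hb_ratio : ∀ i : ℕ, i ≤ m + 1 → b (i + 1) * (i + 1) = b i * ((m : ℝ) + 1 - i) := by
    intro i hi
    rw [hb_succ, hb]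
    have h := Nat.choose_succ_right_eq (m + 1) i
    zify [hi] at h
    exact_mod_cast h
  set a : ℕ → ℝ := fun k => m.choose k / ((k + 1).factorial * (m - k + 1).factorial) /
    ((k + 2).factorial * (m - k + 2).factorial) /
    ((k + 2).factorial * (m - k + 2).factorial) with ha_def
  have ha : IsPosRealRooted m a :=
    (((IsPosRealRooted.choose m).div_factorial 1).div_factorial 2).div_factorial 2
  set K : ℝ := 4 * (m + 2) ^ 2 * (m + 3) * (m + 1).factorial ^ 4 / m.factorial with hK_def
  have hK : 0 < K := by positivity
  have hcoeff : ∀ k ≤ m, 4 * ((b k) ^ 2 - b ((k : ℤ) - 1) * b ((k : ℤ) + 1)) *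
      ((b ((k : ℤ) + 1)) ^ 2 - b k * b ((k : ℤ) + 2)) -
      (b k * b ((k : ℤ) + 1) - b ((k : ℤ) - 1) * b ((k : ℤ) + 2)) ^ 2 = K * a k := by
    intro k hk
    obtain ⟨j, rfl⟩ := Nat.exists_eq_add_of_le hk
    rw [turan_choose_eq k j (hb k), hK_def, ha_def]
    · simp
    · rcases k with _ | i
      · simp [b]
      · have h := hb_ratio i (by omega)
        push_cast at h ⊢
        rw [add_sub_cancel_right, h]
        ring
    · have h := hb_ratio k (by omega)
      push_cast at h
      rw [h]
      ring
    · have h := hb_ratio (k + 1) (by omega)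
      push_cast at h
      rw [show (k : ℤ) + 2 = k + 1 + 1 by ring, show (k : ℝ) + 2 = k + 1 + 1 by ring, h]
      ring
  have hp : p = ∑ k ∈ range (m + 1), C (K * a k) * X ^ k := by
    have h1 : b (((m + 1 : ℕ) : ℤ) + 1) = 0 := by
      rw [hb_succ, Nat.choose_succ_self, Nat.cast_zero]
    have h2 : b (((m + 1 : ℕ) : ℤ) + 2) = 0 := by
      have h := hb_succ (m + 1 + 1)
      rw [Nat.choose_eq_zero_of_lt (by omega), Nat.cast_zero] at h
      rw [← h]
      congr 1
    simp only [p]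
    rw [sum_range_succ, h1, h2]
    simp only [mul_zero, sub_zero, ne_eq, OfNat.ofNat_ne_zero, not_false_eq_true, zero_pow,
      map_zero, zero_mul, add_zero]
    exact sum_congr rfl fun k hk => by rw [hcoeff k (Nat.lt_succ_iff.1 (mem_range.1 hk))]
  rw [hp]
  refine ⟨fun k => ?_, fun z hz => ha.exists_neg ?_⟩
  · simp only [finsetSum_coeff, coeff_C_mul_X_pow]
    refine sum_nonneg fun i hi => ?_
    split_ifs
    · exact (mul_pos hK (ha.1 i (Nat.lt_succ_iff.1 (mem_range.1 hi)))).le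
    · exact le_rfl
  · have h : (K : ℂ) * ∑ k ∈ range (m + 1), (a k : ℂ) * z ^ k = 0 := by
      rw [← hz, mul_sum, map_sum]
      exact sum_congr rfl fun k _ => by simp [mul_assoc]
    exact (mul_eq_zero.1 h).resolve_left (by exact_mod_cast hK.ne')
end

section
/- Let n >= 1 be a natural number. For every k with 0 <= k <= n, one has 4( binom(n,k)^2 - binom(n,k-1) binom(n,k+1) )( binom(n,k+1)^2 - binom(n,k) binom(n,k+2) ) - ( binom(n,k) binom(n,k+1) - binom(n,k-1) binom(n,k+2) )^2 = 4 * n! * (n+1)! * (n+2)! * binom(n,k) / ( (k+1)! * ((k+2)!)^2 * (n-k-1)! * ((n-k+1)!)^2 ), where binom(n,j) = 0 for j < 0 or j > n, and 1/m! = 0 for m < 0. -/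
open Finset

/-- Closed form of the coefficients of `J[(1+x)ⁿ]`: for `n ≥ 1` and `0 ≤ k ≤ n`,
`4(binom(n,k)² - binom(n,k-1)binom(n,k+1))(binom(n,k+1)² - binom(n,k)binom(n,k+2))
  - (binom(n,k)binom(n,k+1) - binom(n,k-1)binom(n,k+2))²
  = 4 n! (n+1)! (n+2)! binom(n,k) / ((k+1)! ((k+2)!)² (n-k-1)! ((n-k+1)!)²)`,
with `binom(n,j) = 0` for `j < 0` or `j > n`, and `1/m! = 0` for `m < 0`. -/
theorem J_binomial_coeff_closed_form (n : ℕ) (hn : 1 ≤ n) (k : ℕ) (hk : k ≤ n) :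
    let b : ℤ → ℝ := fun j => if 0 ≤ j then (n.choose j.toNat : ℝ) else 0
    4 * ((b k) ^ 2 - b ((k : ℤ) - 1) * b ((k : ℤ) + 1)) *
        ((b ((k : ℤ) + 1)) ^ 2 - b k * b ((k : ℤ) + 2)) -
      (b k * b ((k : ℤ) + 1) - b ((k : ℤ) - 1) * b ((k : ℤ) + 2)) ^ 2 =
    4 * n.factorial * (n + 1).factorial * (n + 2).factorial * (n.choose k : ℝ) *
        (if k < n then (1 : ℝ) / (n - k - 1).factorial else 0) /
      ((k + 1).factorial * ((k + 2).factorial : ℝ) ^ 2 * ((n - k + 1).factorial : ℝ) ^ 2) := by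
  intro b
  have hb : ∀ j : ℕ, b (j : ℤ) = n.choose j := fun j => by simp [b]
  have hb1 : b ((k : ℤ) + 1) = n.choose (k + 1) := by exact_mod_cast hb (k + 1)
  have hb2 : b ((k : ℤ) + 2) = n.choose (k + 2) := by exact_mod_cast hb (k + 2)
  rcases hk.eq_or_lt with rfl | hlt
  · simp [hb1, hb2, Nat.choose_eq_zero_of_lt (show k < k + 2 by omega)]
  obtain ⟨m, rfl⟩ : ∃ m, n = k + 1 + m := Nat.exists_eq_add_of_le hlt
  have hk0 : (k : ℝ) + 1 ≠ 0 := by positivity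
  have hk1 : (k : ℝ) + 2 ≠ 0 := by positivity
  have hm2 : (m : ℝ) + 2 ≠ 0 := by positivity
  set a : ℝ := ((k + 1 + m).choose k : ℝ) with ha
  have h1 : b ((k : ℤ) + 1) = a * (m + 1) / (k + 1) := by
    have h := Nat.choose_succ_right_eq (k + 1 + m) k
    rw [show k + 1 + m - k = m + 1 by omega] at h
    rw [hb1, eq_div_iff hk0, ha]
    exact_mod_cast h
  have h2 : b ((k : ℤ) + 2) = a * (m + 1) * m / ((k + 1) * (k + 2)) := by
    have h := Nat.choose_succ_right_eq (k + 1 + m) (k + 1)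
    rw [show k + 1 + m - (k + 1) = m by omega] at h
    have h' : ((k + 1 + m).choose (k + 2) : ℝ) * (k + 2) = b ((k : ℤ) + 1) * m := by
      rw [hb1]
      exact_mod_cast h
    rw [h1] at h'
    rw [hb2, eq_div_iff (by positivity)]
    field_simp at h'
    linear_combination h'
  have h0 : b ((k : ℤ) - 1) = a * k / (m + 2) := by
    rw [eq_div_iff hm2]
    cases k with
    | zero => simp [b]
    | succ j =>
      have h := Nat.choose_succ_right_eq (j + 1 + 1 + m) j
      rw [show j + 1 + 1 + m - j = m + 2 by omega] at h
      rw [show ((j + 1 : ℕ) : ℤ) - 1 = (j : ℤ) by push_cast; ring, hb j, ha]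
      exact_mod_cast h.symm
  have hfact : ((k + 1 + m).factorial : ℝ) = a * k.factorial * ((m + 1) * m.factorial) := by
    have h := Nat.choose_mul_factorial_mul_factorial hk
    rw [show k + 1 + m - k = m + 1 by omega, Nat.factorial_succ m] at h
    rw [ha]
    exact_mod_cast h.symm
  rw [h0, h1, h2, hb k, ← ha, if_pos hlt, show k + 1 + m - k - 1 = m by omega,
    show k + 1 + m - k + 1 = m + 2 by omega]
  simp only [Nat.factorial_succ (k + 1 + m + 1), Nat.factorial_succ (k + 1 + m),
    Nat.factorial_succ (k + 1), Nat.factorial_succ k, Nat.factorial_succ (m + 1),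
    Nat.factorial_succ m, Nat.cast_mul, hfact]
  have hkf : (k.factorial : ℝ) ≠ 0 := by positivity
  have hmf : (m.factorial : ℝ) ≠ 0 := by positivity
  have hm1 : (m : ℝ) + 1 ≠ 0 := by positivity
  push_cast
  rw [show (k : ℝ) + 1 + 1 = k + 2 by ring, show (m : ℝ) + 1 + 1 = m + 2 by ring]
  field_simp
  ring
end

section
/- For every natural number k, with a_j = 1/j! for j >= 0 and a_j = 0 for j < 0, one has 4(a_k^2 - a_{k-1}a_{k+1})(a_{k+1}^2 - a_k a_{k+2}) - (a_k a_{k+1} - a_{k-1} a_{k+2})^2 = 4 / ( k! * (k+1)! * ((k+2)!)^2 ). -/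
open Finset

/-- Closed form of the coefficients of `J[eˣ]`: for every `k : ℕ`, with `aⱼ = 1/j!` for
`j ≥ 0` and `aⱼ = 0` for `j < 0`,
`4(aₖ² - aₖ₋₁aₖ₊₁)(aₖ₊₁² - aₖaₖ₊₂) - (aₖaₖ₊₁ - aₖ₋₁aₖ₊₂)² = 4/(k! (k+1)! ((k+2)!)²)`. -/
theorem J_exp_coeff_closed_form (k : ℕ) :
    let a : ℕ → ℝ := fun j => 1 / j.factorial
    let am : ℝ := if k = 0 then 0 else a (k - 1)
    4 * ((a k) ^ 2 - am * a (k + 1)) * ((a (k + 1)) ^ 2 - a k * a (k + 2)) -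
      (a k * a (k + 1) - am * a (k + 2)) ^ 2 =
    4 / (k.factorial * (k + 1).factorial * ((k + 2).factorial : ℝ) ^ 2) := by
  intro a am
  have ham : am = k / k.factorial := by
    rcases k with _ | n
    · simp [am]
    · have hn : (n.factorial : ℝ) ≠ 0 := by positivity
      have hn' : (n : ℝ) + 1 ≠ 0 := by positivity
      simp only [am, a, Nat.add_eq_zero_iff, one_ne_zero, and_false, if_false,
        Nat.add_sub_cancel, Nat.factorial_succ]
      push_cast
      field_simp
  rw [ham]
  have hk : (k.factorial : ℝ) ≠ 0 := by positivity
  have hk₁ : (k : ℝ) + 1 ≠ 0 := by positivity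
  have hk₂ : (k : ℝ) + 1 + 1 ≠ 0 := by positivity
  simp only [a, Nat.factorial_succ]
  push_cast
  field_simp
  ring
end

section
/- Let a_k = 2^{-k^2} for natural numbers k >= 0 and a_k = 0 for k < 0, and for a fixed natural number r >= 1 define t_k = a_k^2 - a_{k-r} a_{k+r} for k >= 0. Then the sequence {t_k} is rapidly decreasing in the sense that t_k^2 >= 4 t_{k-1} t_{k+1} for every k >= 1 (and each t_k > 0). -/
open Finset

lemma two_zpow_neg_sq_sub_mul_add {k r : ℕ} (h : r ≤ k) :
    (2 : ℝ) ^ (-((k - r : ℕ) : ℤ) ^ 2) * 2 ^ (-((k + r : ℕ) : ℤ) ^ 2) =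
      ((2 : ℝ) ^ (-(k : ℤ) ^ 2)) ^ 2 * 2 ^ (-2 * (r : ℤ) ^ 2) := by
  rw [sq ((2 : ℝ) ^ (-(k : ℤ) ^ 2)), ← zpow_add₀ two_ne_zero, ← zpow_add₀ two_ne_zero,
    ← zpow_add₀ two_ne_zero]
  push_cast [Nat.cast_sub h]
  congr 1
  ring

lemma two_zpow_neg_two_mul_sq_le {r : ℕ} (hr : 1 ≤ r) :
    (2 : ℝ) ^ (-2 * (r : ℤ) ^ 2) ≤ 1 / 4 := by
  have hr' : (1 : ℤ) ≤ r := by exact_mod_cast hr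
  calc (2 : ℝ) ^ (-2 * (r : ℤ) ^ 2) ≤ 2 ^ (-2 : ℤ) :=
        zpow_le_zpow_right₀ one_le_two (by nlinarith)
    _ = 1 / 4 := by norm_num

/-- Let `aₖ = 2^(-k²)` for `k ≥ 0` (and `aₖ = 0` for `k < 0`), and for fixed `r ≥ 1` let
`tₖ = aₖ² - aₖ₋ᵣ aₖ₊ᵣ`.  Then each `tₖ > 0` and the sequence `{tₖ}` is rapidly decreasing:
`tₖ² ≥ 4 tₖ₋₁ tₖ₊₁` for every `k ≥ 1`. -/
theorem Sr_rapidly_decreasing (r : ℕ) (hr : 1 ≤ r) :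
    let a : ℕ → ℝ := fun k => (2 : ℝ) ^ (-(k : ℤ) ^ 2)
    let t : ℕ → ℝ := fun k => (a k) ^ 2 - (if k < r then 0 else a (k - r)) * a (k + r)
    (∀ k, 0 < t k) ∧ ∀ k : ℕ, 1 ≤ k → (t k) ^ 2 ≥ 4 * t (k - 1) * t (k + 1) := by
  intro a t
  have ha : ∀ k, 0 < a k := fun k => zpow_pos two_pos _
  have hbound : ∀ k, 3 / 4 * a k ^ 2 ≤ t k ∧ t k ≤ a k ^ 2 := by
    intro k
    have hak := pow_pos (ha k) 2
    by_cases h : k < r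
    · have : t k = a k ^ 2 := by simp [t, h]
      constructor <;> linarith
    · have ht : t k = a k ^ 2 - a k ^ 2 * 2 ^ (-2 * (r : ℤ) ^ 2) := by
        simp only [t, if_neg h]
        rw [← two_zpow_neg_sq_sub_mul_add (not_lt.mp h)]
      have hq := two_zpow_neg_two_mul_sq_le hr
      have hq0 : (0 : ℝ) < 2 ^ (-2 * (r : ℤ) ^ 2) := zpow_pos two_pos _
      constructor <;> nlinarith
  have hpos : ∀ k, 0 < t k := fun k =>
    lt_of_lt_of_le (mul_pos (by norm_num) (pow_pos (ha k) 2)) (hbound k).1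
  refine ⟨hpos, fun k hk => ?_⟩
  have hrec : a (k - 1) * a (k + 1) = a k ^ 2 / 4 := by
    have h := two_zpow_neg_sq_sub_mul_add hk
    norm_num at h
    simpa [a, div_eq_mul_inv] using h
  calc 4 * t (k - 1) * t (k + 1)
      ≤ 4 * a (k - 1) ^ 2 * a (k + 1) ^ 2 := by
        have := hpos (k + 1)
        gcongr
        exacts [(hbound _).2, (hbound _).2]
    _ = 4 * (a (k - 1) * a (k + 1)) ^ 2 := by ring
    _ = (1 / 2 * a k ^ 2) ^ 2 := by rw [hrec]; ring
    _ ≤ t k ^ 2 := by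
        gcongr
        linarith [(hbound k).1, pow_pos (ha k) 2]
end
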